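/- There exist absolute constants C, c > 0 such that lim_{n→∞} inf_{λ} P( c·(e^{−1} − λ)^{−1}·log n ≤ L(n,λ) ≤ C·(e^{−1} − λ)^{−1}·log n ) = 1, where the infimum is over all λ with 1/4 ≤ λ ≤ e^{−1} − (log n)^{−2} (the near-subcritical regime, with λ bounded away from 0). -/

import Mathlib

open MeasureTheory ProbabilityTheory Filter Finset

namespace Paper

/-- A path of length `ℓ` in the complete graph on `Fin n`: a sequence of `ℓ+1` distinct
vertices. -/
abbrev Path (n ℓ : ℕ) := {v : Fin (ℓ + 1) → Fin n // Function.Injective v}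

/-- The `i`-th edge of a path. -/
def Path.edge {n ℓ : ℕ} (γ : Path n ℓ) (i : Fin ℓ) : Sym2 (Fin n) :=
  s(γ.1 i.castSucc, γ.1 i.succ)

/-- The total weight `X(γ)` of a path. -/
noncomputable def weight {n ℓ : ℕ} (ω : Sym2 (Fin n) → ℝ) (γ : Path n ℓ) : ℝ :=
  ∑ i : Fin ℓ, ω (γ.edge i)

/-- Partial sum of the first `k` edge weights of a path. -/
noncomputable def partialSum {n ℓ : ℕ} (ω : Sym2 (Fin n) → ℝ) (γ : Path n ℓ) (k : ℕ) : ℝ :=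
  ∑ i : Fin ℓ, if (i : ℕ) < k then ω (γ.edge i) else 0

/-- The deviation `M(γ) = max_{1 ≤ k ≤ ℓ} |∑_{i=1}^k X_{e_i} - (k/ℓ) X(γ)|`. -/
noncomputable def deviation {n ℓ : ℕ} (ω : Sym2 (Fin n) → ℝ) (γ : Path n ℓ) : ℝ :=
  ⨆ k : Fin ℓ, |partialSum ω γ ((k : ℕ) + 1) - (((k : ℕ) + 1 : ℝ) / ℓ) * weight ω γ|

/-- The law of the i.i.d. edge weights: each edge carries an exponential variable with
mean `n` (rate `1/n`). -/
noncomputable def P (n : ℕ) : Measure (Sym2 (Fin n) → ℝ) :=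
  Measure.pi fun _ => expMeasure ((n : ℝ)⁻¹)

/-- `L n λ ω` : the maximal `ℓ` such that some path of length `ℓ` has weight at most `λℓ`
(`0` if there is none). -/
noncomputable def L (n : ℕ) (lam : ℝ) (ω : Sym2 (Fin n) → ℝ) : ℕ :=
  sSup {ℓ : ℕ | ∃ γ : Path n ℓ, weight ω γ ≤ lam * ℓ}

lemma trig_one {β t : ℝ} (hβ : 0 < β) (hβ1 : β ≤ 1) (ht : 0 ≤ t) (htB : β * t ≤ Real.pi) :
    Real.sin (β * t) ≤ Real.exp (t - 1 - max (t-1) 0) *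
      (Real.sin (β * max (t-1) 0) + β * Real.cos (β * max (t-1) 0)) := by
  rcases le_total t 1 with h | h
  · rw [max_eq_right (by linarith)]
    simp only [mul_zero, Real.sin_zero, Real.cos_zero, sub_zero, zero_add, mul_one]
    have h1 : t ≤ Real.exp (t - 1) := by linarith [Real.add_one_le_exp (t-1)]
    have h2 : Real.sin (β * t) ≤ β * t := Real.sin_le (by positivity)
    nlinarith
  · rw [max_eq_left (by linarith)]
    simp only [sub_self, Real.exp_zero, one_mul]
    have e : β * (t - 1) = β * t - β := by ring
    rw [e, Real.sin_sub, Real.cos_sub]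
    have hs0 : 0 ≤ Real.sin (β * t) := Real.sin_nonneg_of_nonneg_of_le_pi (by positivity) htB
    have hc : 1 - β^2/2 ≤ Real.cos β := Real.one_sub_sq_div_two_le_cos
    have hsβ : Real.sin β ≤ β := Real.sin_le hβ.le
    have hsβ2 : β - β^3/6 < Real.sin β := Real.sin_gt_sub_cube hβ
    have hk : β * Real.cos β ≤ Real.sin β := by
      have := Real.le_tan hβ.le (by linarith [Real.pi_gt_three])
      have hcp : 0 < Real.cos β := Real.cos_pos_of_mem_Ioo ⟨by linarith [Real.pi_gt_three], by linarith [Real.pi_gt_three]⟩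
      rw [Real.tan_eq_sin_div_cos, le_div_iff₀ hcp] at this
      exact this
    rcases le_or_gt (Real.cos (β * t)) 0 with h0 | h0
    · have h1 : 1 ≤ Real.cos β + β * Real.sin β := by
        have : β ^ 4 ≤ β ^ 2 := by nlinarith [sq_nonneg β, pow_le_one₀ (n := 2) hβ.le hβ1]
        nlinarith
      nlinarith [mul_nonneg (sub_nonneg.2 hk) (neg_nonneg.2 h0), mul_nonneg hs0 (sub_nonneg.2 h1)]
    · have hlt : β * t < Real.pi / 2 := by
        by_contra hh
        push Not at hh
        have := Real.cos_nonpos_of_pi_div_two_le_of_le hh (by linarith [Real.pi_pos])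
        linarith
      have h1 : β * Real.cos (β * t) ≤ Real.sin (β * t) := by
        have := Real.le_tan (x := β * t) (by positivity) hlt
        rw [Real.tan_eq_sin_div_cos, le_div_iff₀ h0] at this
        nlinarith
      -- multiply by β
      have h2 : (1:ℝ) ≤ 2 * Real.cos β + β * Real.sin β - Real.sin β / β := by
        have : Real.sin β / β ≤ 1 + (β * Real.sin β - β^2) := by
          rw [div_le_iff₀ hβ]
          nlinarith [mul_nonneg (sub_nonneg.2 hsβ) (sub_nonneg.2 (pow_le_one₀ (n := 2) hβ.le hβ1))]
        linarith
      have h3 : (Real.sin β - β * Real.cos β) * Real.cos (β*t) ≤ (Real.sin β / β - Real.cos β) * Real.sin (β * t) := by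
        have : Real.sin β - β * Real.cos β = (Real.sin β / β - Real.cos β) * β := by field_simp
        rw [this, mul_assoc]
        apply mul_le_mul_of_nonneg_left h1
        rw [sub_nonneg, le_div_iff₀ hβ]; linarith
      nlinarith

lemma one_step {β lam r t : ℝ} (hβ : 0 < β) (hβ1 : β ≤ 1) (hl : 0 < lam) (hr : 0 < r)
    (ht : 0 ≤ t) (htB : t ≤ Real.pi / β) :
    ENNReal.ofReal (r * lam * Real.exp (1 - r * lam) / (1 + β^2) *
      (Real.sin (β * t) * Real.exp (-(1 - r * lam) * t)))
    ≤ ∫⁻ x, (Set.Icc 0 (Real.pi / β)).indicator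
        (fun u => ENNReal.ofReal (Real.sin (β * u) * Real.exp (-(1 - r * lam) * u)))
          (t + (x / lam - 1)) ∂(expMeasure r) := by
  set B := Real.pi / β with hB
  have hBβ : β * B = Real.pi := by rw [hB]; field_simp
  have hB0 : 0 < B := div_pos Real.pi_pos hβ
  set s := max (t-1) 0 with hs
  have hs0 : 0 ≤ s := le_max_right _ _
  have hst : t - 1 ≤ s := le_max_left _ _
  have hsB : s ≤ B := max_le (by linarith) hB0.le
  set a := lam * (s - t + 1) with ha
  set b := lam * (B - t + 1) with hb
  have ha0 : 0 ≤ a := mul_nonneg hl.le (by linarith)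
  have hab : a ≤ b := mul_le_mul_of_nonneg_left (by linarith) hl.le
  set F : ℝ → ℝ := fun x => -(lam * r * Real.exp (-(r * x)) * Real.exp (-(1 - r * lam) * (t + (x/lam - 1))) *
    (Real.sin (β * (t + (x/lam - 1))) + β * Real.cos (β * (t + (x/lam - 1)))) / (1 + β^2)) with hF
  set f : ℝ → ℝ := fun x => r * Real.exp (-(r * x)) * (Real.sin (β * (t + (x/lam - 1))) *
    Real.exp (-(1 - r * lam) * (t + (x/lam - 1)))) with hf
  have hfc : Continuous f := by rw [hf]; fun_prop
  have hderiv : ∀ x, HasDerivAt F (f x) x := by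
    intro x
    have h1 : HasDerivAt (fun x : ℝ => t + (x/lam - 1)) (1/lam) x :=
      (((hasDerivAt_id x).div_const lam).sub_const 1).const_add t
    have h2 : HasDerivAt (fun x : ℝ => -(r * x)) (-(r * 1)) x := ((hasDerivAt_id x).const_mul r).neg
    have h3 := (h1.const_mul (-(1 - r * lam))).exp
    have h4 := (h1.const_mul β).sin
    have h5 := (h1.const_mul β).cos
    have h6 := ((((h2.exp.const_mul (lam * r)).mul h3).mul (h4.add (h5.const_mul β))).div_const (1 + β^2)).neg
    convert! h6 using 1
    simp only [hf]
    field_simp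
    simp only [Pi.mul_apply, Pi.add_apply]
    ring_nf
  have hint : ∫ x in a..b, f x = F b - F a :=
    intervalIntegral.integral_eq_sub_of_hasDerivAt (fun x _ => hderiv x) (hfc.intervalIntegrable _ _)
  have hval : r * lam * Real.exp (1 - r * lam) / (1 + β^2) *
      (Real.sin (β * t) * Real.exp (-(1 - r * lam) * t)) ≤ F b - F a := by
    have tb : t + (b / lam - 1) = B := by rw [hb]; field_simp; ring
    have ta : t + (a / lam - 1) = s := by rw [ha]; field_simp; ring
    have hFb : 0 ≤ F b := by
      simp only [hF, tb, hBβ, Real.sin_pi, Real.cos_pi, zero_add, mul_neg, mul_one]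
      rw [neg_div, neg_neg]
      positivity
    have hFa : -F a = r * lam * Real.exp (1 - r * lam) / (1 + β^2) * Real.exp (-(1-r*lam)*t) *
       (Real.exp (t - 1 - s) * (Real.sin (β * s) + β * Real.cos (β * s))) := by
      simp only [hF, ta]
      have : Real.exp (-(r*a)) * Real.exp (-(1 - r*lam) * s) =
         Real.exp (1 - r * lam) * Real.exp (-(1-r*lam)*t) * Real.exp (t - 1 - s) := by
        rw [← Real.exp_add, ← Real.exp_add, ← Real.exp_add]; congr 1; rw [ha]; ring
      linear_combination (lam * r / (1 + β^2) * (Real.sin (β * s) + β * Real.cos (β * s))) * this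
    have htr := trig_one hβ hβ1 ht (by rw [← hBβ]; gcongr)
    rw [← hs] at htr
    have : r * lam * Real.exp (1 - r * lam) / (1 + β^2) *
      (Real.sin (β * t) * Real.exp (-(1 - r * lam) * t)) ≤ - F a := by
      rw [hFa]
      calc _ = r * lam * Real.exp (1 - r * lam) / (1 + β^2) * Real.exp (-(1-r*lam)*t) * Real.sin (β * t) := by ring
        _ ≤ _ := by gcongr
    linarith
  have hfn : ∀ x ∈ Set.Ioc a b, 0 ≤ f x ∧ t + (x/lam-1) ∈ Set.Icc 0 B := by
    intro x hx
    have h1 : 0 ≤ t + (x/lam-1) := by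
      have : s - t + 1 ≤ x / lam := by rw [le_div_iff₀ hl]; linarith [hx.1]
      linarith
    have h2 : t + (x/lam-1) ≤ B := by
      have : x / lam ≤ B - t + 1 := by rw [div_le_iff₀ hl]; linarith [hx.2]
      linarith
    refine ⟨?_, h1, h2⟩
    have : 0 ≤ Real.sin (β * (t + (x/lam - 1))) :=
      Real.sin_nonneg_of_nonneg_of_le_pi (by positivity) (by rw [← hBβ]; gcongr)
    simp only [hf]
    positivity
  calc _ ≤ ENNReal.ofReal (∫ x in a..b, f x) := ENNReal.ofReal_le_ofReal (hint ▸ hval)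
    _ = ∫⁻ x in Set.Ioc a b, ENNReal.ofReal (f x) := by
      rw [intervalIntegral.integral_of_le hab, ofReal_integral_eq_lintegral_ofReal]
      · exact (hfc.intervalIntegrable a b).1
      · exact (ae_restrict_iff' measurableSet_Ioc).2 (ae_of_all _ fun x hx => (hfn x hx).1)
    _ ≤ ∫⁻ x in Set.Ioc a b, exponentialPDF r x * (Set.Icc 0 B).indicator
        (fun u => ENNReal.ofReal (Real.sin (β * u) * Real.exp (-(1 - r * lam) * u)))
          (t + (x / lam - 1)) := by
      apply setLIntegral_mono' measurableSet_Ioc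
      intro x hx
      rw [Set.indicator_of_mem (hfn x hx).2, exponentialPDF_of_nonneg (by linarith [hx.1]),
        ← ENNReal.ofReal_mul (by positivity)]
    _ ≤ ∫⁻ x, exponentialPDF r x * (Set.Icc 0 B).indicator
        (fun u => ENNReal.ofReal (Real.sin (β * u) * Real.exp (-(1 - r * lam) * u)))
          (t + (x / lam - 1)) := setLIntegral_le_lintegral _ _
    _ = _ := by
      rw [expMeasure, gammaMeasure, lintegral_withDensity_eq_lintegral_mul]
      · rfl
      · exact (measurable_gammaPDFReal 1 r).ennreal_ofReal
      · apply Measurable.comp (g := (Set.Icc 0 B).indicator _)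
        · apply Measurable.indicator _ measurableSet_Icc
          fun_prop
        · fun_prop

lemma exp_laplace {r s : ℝ} (hr : 0 < r) (hs : 0 ≤ s) :
    ∫⁻ x, ENNReal.ofReal (Real.exp (-(s * x))) ∂(expMeasure r) = ENNReal.ofReal (r / (r + s)) := by
  rw [expMeasure, gammaMeasure, lintegral_withDensity_eq_lintegral_mul]
  · have : ∀ x, (gammaPDF 1 r * fun x => ENNReal.ofReal (Real.exp (-(s * x)))) x =
        ENNReal.ofReal (r / (r+s)) * exponentialPDF (r+s) x := by
      intro x
      change exponentialPDF r x * _ = _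
      rw [exponentialPDF_eq, exponentialPDF_eq]
      split_ifs with h
      · rw [← ENNReal.ofReal_mul (by positivity), ← ENNReal.ofReal_mul (by positivity)]
        congr 1
        have : Real.exp (-((r+s)*x)) = Real.exp (-(r*x)) * Real.exp (-(s*x)) := by
          rw [← Real.exp_add]; congr 1; ring
        rw [this]
        have : r + s ≠ 0 := by positivity
        field_simp
      · simp
    simp_rw [this]
    rw [lintegral_const_mul', lintegral_exponentialPDF_eq_one (by positivity), mul_one]
    exact ENNReal.ofReal_ne_top
  · exact (measurable_gammaPDFReal 1 r).ennreal_ofReal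
  · fun_prop

/-- Walk started at `t` with increments `x i / lam - 1` stays in `[0,B]` (after time 0). -/
def W (B lam : ℝ) : (k : ℕ) → ℝ → (Fin k → ℝ) → Prop
  | 0, _, _ => True
  | k + 1, t, x => (t + (x 0 / lam - 1)) ∈ Set.Icc 0 B ∧ W B lam k (t + (x 0 / lam - 1)) (Fin.tail x)

lemma W_meas (B lam : ℝ) (k : ℕ) : MeasurableSet {q : ℝ × (Fin k → ℝ) | W B lam k q.1 q.2} := by
  induction k with
  | zero => simp [W]
  | succ k ih =>
    have h1 : Measurable (fun q : ℝ × (Fin (k+1) → ℝ) => q.1 + (q.2 0 / lam - 1)) := by fun_prop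
    have h2 : Measurable (fun q : ℝ × (Fin (k+1) → ℝ) => (q.1 + (q.2 0 / lam - 1), Fin.tail q.2)) := by
      refine h1.prodMk ?_
      unfold Fin.tail
      fun_prop
    exact (h1 measurableSet_Icc).inter (h2 ih)

lemma W_meas' (B lam : ℝ) (k : ℕ) (t : ℝ) : MeasurableSet {x : Fin k → ℝ | W B lam k t x} :=
  (measurable_prodMk_left (x := t)) (W_meas B lam k)

lemma W_lower {β lam r : ℝ} (hβ : 0 < β) (hβ1 : β ≤ 1) (hl : 0 < lam) (hr : 0 < r)
    (hrl : r * lam ≤ 1) (k : ℕ) : ∀ t : ℝ, 0 ≤ t → t ≤ Real.pi / β →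
    ENNReal.ofReal ((r * lam * Real.exp (1 - r * lam) / (1 + β^2))^k *
      (Real.sin (β * t) * Real.exp (-(1 - r * lam) * t)))
    ≤ (Measure.pi fun _ : Fin k => expMeasure r) {x | W (Real.pi / β) lam k t x} := by
  have := isProbabilityMeasure_expMeasure hr
  induction k with
  | zero =>
    intro t ht htB
    simp only [W, Set.ofPred_true, measure_univ, pow_zero, one_mul]
    rw [← ENNReal.ofReal_one]
    apply ENNReal.ofReal_le_ofReal
    have h1 : Real.sin (β * t) ≤ 1 := Real.sin_le_one _
    have h2 : Real.exp (-(1 - r * lam) * t) ≤ 1 := by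
      apply Real.exp_le_one_iff.2
      nlinarith
    have := Real.exp_pos (-(1 - r * lam) * t)
    nlinarith
  | succ k ih =>
    intro t ht htB
    set κ := r * lam * Real.exp (1 - r * lam) / (1 + β^2) with hκ
    have hκ0 : 0 ≤ κ := by positivity
    have mp := measurePreserving_piFinSuccAbove (fun _ : Fin (k+1) => expMeasure r) 0
    have hset : {x | W (Real.pi / β) lam (k+1) t x} =
        (MeasurableEquiv.piFinSuccAbove (fun _ : Fin (k+1) => ℝ) 0) ⁻¹'
          {q : ℝ × (Fin k → ℝ) | (t + (q.1 / lam - 1)) ∈ Set.Icc 0 (Real.pi / β) ∧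
            W (Real.pi / β) lam k (t + (q.1 / lam - 1)) q.2} := by
      ext x
      simp only [W, Set.mem_ofPred_eq, Set.mem_preimage, MeasurableEquiv.piFinSuccAbove_apply]
      rfl
    have hm : MeasurableSet {q : ℝ × (Fin k → ℝ) | (t + (q.1 / lam - 1)) ∈ Set.Icc 0 (Real.pi / β) ∧
            W (Real.pi / β) lam k (t + (q.1 / lam - 1)) q.2} := by
      have h1 : Measurable (fun q : ℝ × (Fin k → ℝ) => t + (q.1 / lam - 1)) := by fun_prop
      have h2 : Measurable (fun q : ℝ × (Fin k → ℝ) => (t + (q.1 / lam - 1), q.2)) := by fun_prop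
      exact (h1 measurableSet_Icc).inter (h2 (W_meas _ lam k))
    rw [hset, mp.measure_preimage hm.nullMeasurableSet, Measure.prod_apply hm]
    calc _ = ENNReal.ofReal (κ^k) * ENNReal.ofReal (κ * (Real.sin (β * t) * Real.exp (-(1 - r * lam) * t))) := by
          rw [← ENNReal.ofReal_mul (by positivity)]; congr 1; ring
      _ ≤ ENNReal.ofReal (κ^k) * ∫⁻ x, (Set.Icc 0 (Real.pi / β)).indicator
        (fun u => ENNReal.ofReal (Real.sin (β * u) * Real.exp (-(1 - r * lam) * u)))
          (t + (x / lam - 1)) ∂(expMeasure r) := by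
          gcongr
          exact one_step hβ hβ1 hl hr ht htB
      _ = ∫⁻ x, ENNReal.ofReal (κ^k) * (Set.Icc 0 (Real.pi / β)).indicator
        (fun u => ENNReal.ofReal (Real.sin (β * u) * Real.exp (-(1 - r * lam) * u)))
          (t + (x / lam - 1)) ∂(expMeasure r) := by
          rw [lintegral_const_mul' _ _ ENNReal.ofReal_ne_top]
      _ ≤ _ := by
          apply lintegral_mono
          intro x
          by_cases hx : (t + (x / lam - 1)) ∈ Set.Icc 0 (Real.pi / β)
          · simp only [Set.indicator_of_mem hx]
            rw [← ENNReal.ofReal_mul (by positivity)]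
            refine (ih _ hx.1 hx.2).trans (le_of_eq ?_)
            congr 1
            ext y
            simp only [Set.mem_ofPred_eq, Set.mem_preimage]
            exact ⟨fun h => ⟨hx, h⟩, fun h => h.2⟩
          · simp [Set.indicator_of_notMem hx]

/-- number of run starts -/
def st : (k : ℕ) → Bool → (Fin k → Bool) → ℕ
  | 0, _, _ => 0
  | k + 1, b, s => (if s 0 && !b then 1 else 0) + st k (s 0) (Fin.tail s)

lemma W_sum {B lam : ℝ} (k : ℕ) : ∀ (t : ℝ) (b : Bool) (s : Fin k → Bool) (x : Fin k → ℝ),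
    0 ≤ t → t ≤ B → W B lam k t x →
    ∑ i, (if s i then 0 else (x i / lam - 1)) ≤ B * st k b s + (if b then B else B - t) := by
  induction k with
  | zero => intro t b s x h0 h1 _; cases b <;> simp [st] <;> linarith
  | succ k ih =>
    intro t b s x h0 h1 hW
    obtain ⟨⟨ha, hb⟩, hW'⟩ := hW
    have := ih (t + (x 0 / lam - 1)) (s 0) (Fin.tail s) (Fin.tail x) ha hb hW'
    rw [Fin.sum_univ_succ]
    change ∑ i : Fin k, (if s i.succ then 0 else (x i.succ / lam - 1)) ≤ _ at this
    simp only [st]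
    rcases Bool.eq_false_or_eq_true (s 0) with h | h <;> cases b <;> simp [h] at this ⊢ <;> linarith

lemma W_total {B lam : ℝ} (hl : 0 < lam) (k : ℕ) (t : ℝ) (x : Fin k → ℝ) (h0 : 0 ≤ t) (h1 : t ≤ B)
    (hW : W B lam k t x) : ∑ i, x i ≤ lam * (k + (B - t)) := by
  have hst : ∀ k, st k false (fun _ => false) = 0 := by
    intro k; induction k with
    | zero => rfl
    | succ k ih => simp only [st]; simpa using! ih
  have := W_sum k t false (fun _ => false) x h0 h1 hW
  rw [hst] at this
  simp only [Bool.false_eq_true, if_false, Finset.sum_sub_distrib, Finset.sum_const, Finset.card_univ, Fintype.card_fin, nsmul_eq_mul, mul_one, ← Finset.sum_div] at this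
  have h2 : (∑ i, x i) / lam ≤ k + (B - t) := by push_cast at this; linarith
  rw [div_le_iff₀ hl] at h2
  linarith

/-- cost of a shared pattern -/
noncomputable def cost (E : ℝ) (k : ℕ) (b : Bool) (s : Fin k → Bool) (g : Fin k → ℝ) : ℝ :=
  E ^ (st k b s) * ∏ i, if s i then 1 else g i

lemma cost_succ (E : ℝ) (k : ℕ) (b : Bool) (s : Fin (k+1) → Bool) (g : Fin (k+1) → ℝ) :
    cost E (k+1) b s g = (if s 0 then (if b then 1 else E) else g 0) *
      cost E k (s 0) (Fin.tail s) (Fin.tail g) := by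
  unfold cost
  rw [Fin.prod_univ_succ]
  simp only [st]
  change _ * (_ * ∏ i : Fin k, if s i.succ then 1 else g i.succ) =
    _ * (_ * ∏ i : Fin k, if s i.succ then 1 else g i.succ)
  rcases Bool.eq_false_or_eq_true (s 0) with h | h <;> cases b <;> simp [h] <;> ring

open Classical in
/-- shared pattern of a vertex sequence -/
noncomputable def sh {V : Type*} (adj : V → V → Prop) {r : ℕ} (v : Fin (r+1) → V) (i : Fin r) : Bool :=
  decide (adj (v i.castSucc) (v i.succ))

lemma sh_tail {V : Type*} (adj : V → V → Prop) {r : ℕ} (v : Fin (r+1+1) → V) :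
    Fin.tail (sh adj v) = sh adj (Fin.tail v) := by
  ext i; rfl

open Classical in
/-- recursive majorant -/
noncomputable def Fr {V : Type*} [Fintype V] (adj : V → V → Prop) (E N : ℝ) : ℕ → Bool → V → V → ℝ
  | 0, _, _, _ => 1
  | r+1, b, u, v => ∑ a, if a = u then 0 else
      if adj v a then (if b then 1 else E) * Fr adj E N r true v a else N⁻¹ * Fr adj E N r false v a

open Classical in
/-- recursive majorant with at least one shared edge -/
noncomputable def Hr {V : Type*} [Fintype V] (adj : V → V → Prop) (E N : ℝ) : ℕ → V → ℝ
  | 0, _ => 0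
  | r+1, v => ∑ a, if adj v a then E * Fr adj E N r true v a else N⁻¹ * Hr adj E N r a

section
variable {V : Type*} [Fintype V] (adj : V → V → Prop) {E N : ℝ}

lemma Fr_nonneg (hE : 0 ≤ E) (hN : 0 ≤ N) (r : ℕ) : ∀ b u v, 0 ≤ Fr adj E N r b u v := by
  induction r with
  | zero => intro b u v; simp [Fr]
  | succ r ih =>
    intro b u v
    simp only [Fr]
    apply Finset.sum_nonneg
    intro a _
    have := ih true v a
    have := ih false v a
    split_ifs <;> positivity

lemma Hr_nonneg (hE : 0 ≤ E) (hN : 0 ≤ N) (r : ℕ) : ∀ v, 0 ≤ Hr adj E N r v := by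
  induction r with
  | zero => intro v; simp [Hr]
  | succ r ih =>
    intro v
    simp only [Hr]
    apply Finset.sum_nonneg
    intro a _
    have := Fr_nonneg adj hE hN r true v a
    have := ih a
    split_ifs <;> positivity

lemma sum_cons {r : ℕ} (f : (Fin (r+1) → V) → ℝ) :
    ∑ w, f w = ∑ a : V, ∑ w : Fin r → V, f (Fin.cons a w) := by
  rw [← Fintype.sum_prod_type' (f := fun a w => f (Fin.cons a w))]
  exact (Fintype.sum_equiv (Fin.consEquiv (fun _ : Fin (r+1) => V)) _ _ (fun x => rfl)).symm

lemma inj_tail {V : Type*} {r : ℕ} {u : V} {w : Fin r → V} (h : Function.Injective (Fin.cons u w : Fin (r+1) → V)) :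
    Function.Injective w := (Fin.cons_injective_iff.1 h).2

open Classical in
lemma sum_le_Fr (hE : 0 ≤ E) (hN : 0 ≤ N) (r : ℕ) : ∀ b u v,
    ∑ w : Fin r → V, (if Function.Injective (Fin.cons u (Fin.cons v w : Fin (r+1) → V) : Fin (r+2) → V) then
      cost E r b (sh adj (Fin.cons v w : Fin (r+1) → V)) (fun _ => N⁻¹) else 0) ≤ Fr adj E N r b u v := by
  induction r with
  | zero => intro b u v; simp [Fr, cost, st]; exact (Finset.card_filter_le _ _).trans (by simp)
  | succ r ih =>
    intro b u v
    rw [sum_cons]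
    simp only [Fr]
    apply Finset.sum_le_sum
    intro a _
    have hsh0 : ∀ w : Fin r → V, sh adj (Fin.cons v (Fin.cons a w : Fin (r+1) → V) : Fin (r+2) → V) 0 = decide (adj v a) := by
      intro w; rfl
    have hsht : ∀ w : Fin r → V, Fin.tail (sh adj (Fin.cons v (Fin.cons a w : Fin (r+1) → V) : Fin (r+2) → V))
       = sh adj (Fin.cons a w : Fin (r+1) → V) := by
      intro w; rw [sh_tail]; rw [Fin.tail_cons]
    by_cases hau : a = u
    · rw [if_pos hau]
      apply le_of_eq
      apply Finset.sum_eq_zero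
      intro w _
      rw [if_neg]
      intro h
      have := @h 0 (Fin.succ (Fin.succ 0)) hau.symm
      exact (Fin.succ_ne_zero _) this.symm
    rw [if_neg hau]
    set cf : ℝ := if adj v a then (if b then 1 else E) else N⁻¹ with hcf
    have hcf0 : 0 ≤ cf := by rw [hcf]; split_ifs <;> positivity
    have key : ∀ w : Fin r → V, (if Function.Injective (Fin.cons u (Fin.cons v (Fin.cons a w : Fin (r+1) → V) : Fin (r+2) → V) : Fin (r+3) → V) then
      cost E (r+1) b (sh adj (Fin.cons v (Fin.cons a w : Fin (r+1) → V) : Fin (r+2) → V)) (fun _ => N⁻¹) else 0) ≤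
      cf * (if Function.Injective (Fin.cons v (Fin.cons a w : Fin (r+1) → V) : Fin (r+2) → V) then
      cost E r (decide (adj v a)) (sh adj (Fin.cons a w : Fin (r+1) → V)) (fun _ => N⁻¹) else 0) := by
      intro w
      by_cases h : Function.Injective (Fin.cons u (Fin.cons v (Fin.cons a w : Fin (r+1) → V) : Fin (r+2) → V) : Fin (r+3) → V)
      · rw [if_pos h, if_pos (inj_tail h), cost_succ, hsh0, hsht]
        apply le_of_eq
        congr 1
        simp [hcf]
      · rw [if_neg h]
        apply mul_nonneg hcf0
        split_ifs
        · unfold cost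
          apply mul_nonneg (by positivity)
          apply Finset.prod_nonneg
          intro i _
          split_ifs <;> positivity
        · exact le_rfl
    refine (Finset.sum_le_sum fun w _ => key w).trans ?_
    rw [← Finset.mul_sum]
    refine (mul_le_mul_of_nonneg_left (ih _ v a) hcf0).trans (le_of_eq ?_)
    rw [hcf]
    by_cases h : adj v a <;> simp [h]

open Classical in
lemma sum_le_Hr (hE : 0 ≤ E) (hN : 0 ≤ N) (r : ℕ) : ∀ v,
    ∑ w : Fin r → V, (if Function.Injective (Fin.cons v w : Fin (r+1) → V) ∧
        (∃ i, sh adj (Fin.cons v w : Fin (r+1) → V) i = true) then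
      cost E r false (sh adj (Fin.cons v w : Fin (r+1) → V)) (fun _ => N⁻¹) else 0) ≤ Hr adj E N r v := by
  induction r with
  | zero => intro v; simp [Hr]
  | succ r ih =>
    intro v
    rw [sum_cons]
    simp only [Hr]
    apply Finset.sum_le_sum
    intro a _
    have hsh0 : ∀ w : Fin r → V, sh adj (Fin.cons v (Fin.cons a w : Fin (r+1) → V) : Fin (r+2) → V) 0 = decide (adj v a) := by
      intro w; rfl
    have hsht : ∀ w : Fin r → V, Fin.tail (sh adj (Fin.cons v (Fin.cons a w : Fin (r+1) → V) : Fin (r+2) → V))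
       = sh adj (Fin.cons a w : Fin (r+1) → V) := by
      intro w; rw [sh_tail]; rw [Fin.tail_cons]
    by_cases h : adj v a
    · rw [if_pos h]
      refine le_trans ?_ (mul_le_mul_of_nonneg_left (sum_le_Fr adj hE hN r true v a) hE)
      rw [Finset.mul_sum]
      apply Finset.sum_le_sum
      intro w _
      by_cases hi : Function.Injective (Fin.cons v (Fin.cons a w : Fin (r+1) → V) : Fin (r+2) → V)
      · have : (∃ i, sh adj (Fin.cons v (Fin.cons a w : Fin (r+1) → V) : Fin (r+2) → V) i = true) :=
          ⟨0, by rw [hsh0]; simpa using h⟩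
        rw [if_pos ⟨hi, this⟩, if_pos hi, cost_succ, hsh0, hsht]
        simp [h]
        rfl
      · simp [hi]
    · rw [if_neg h]
      refine le_trans ?_ (mul_le_mul_of_nonneg_left (ih a) (by positivity))
      rw [Finset.mul_sum]
      apply Finset.sum_le_sum
      intro w _
      by_cases hi : Function.Injective (Fin.cons v (Fin.cons a w : Fin (r+1) → V) : Fin (r+2) → V) ∧ 
         (∃ i, sh adj (Fin.cons v (Fin.cons a w : Fin (r+1) → V) : Fin (r+2) → V) i = true)
      · have : (∃ i, sh adj (Fin.cons a w : Fin (r+1) → V) i = true) := by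
          obtain ⟨i, hi⟩ := hi.2
          rw [← hsht w]
          cases i using Fin.cases with
          | zero => rw [hsh0] at hi; simp [h] at hi
          | succ j => exact ⟨j, hi⟩
        rw [if_pos hi, if_pos ⟨inj_tail hi.1, this⟩, cost_succ, hsh0, hsht]
        simp [h]
        rfl
      · rw [if_neg hi]
        apply mul_nonneg (by positivity)
        split_ifs
        · unfold cost
          apply mul_nonneg (by positivity)
          apply Finset.prod_nonneg
          intro i _
          split_ifs <;> positivity
        · exact le_rfl

open Classical in
lemma Fr_bound {ℓ : ℕ} {D Q δ : ℝ} (hE : 1 ≤ E) (hN : N = Fintype.card V) (hN0 : 0 < N)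
    (hsymm : ∀ a b, adj a b → adj b a)
    (S : Finset V) (hS : ∀ a b, adj a b → a ∈ S) (hD : (S.card : ℝ) ≤ D)
    (hdeg : ∀ v, (univ.filter (fun a => adj v a)).card ≤ 2)
    (hQ : Q = 2 * E * (2 * ℓ + 1) + 2) (hδ : δ = D * Q / N) (hℓ : ℓ * δ ≤ 1) (r : ℕ) : r ≤ ℓ →
    (∀ u v, adj u v → Fr adj E N r true u v ≤ 2 * r + 1) ∧
    (∀ u v, Fr adj E N r false u v ≤ Q) ∧
    (∀ u v, v ∉ S → Fr adj E N r false u v ≤ 1 + r * δ) := by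
  have hD0 : 0 ≤ D := le_trans (by positivity) hD
  have hQ0 : 1 ≤ Q := by
    have : 0 ≤ 2 * E * (2 * ℓ + 1) := by positivity
    linarith
  have hδ0 : 0 ≤ δ := by rw [hδ]; positivity
  induction r with
  | zero => intro _; simp [Fr, hQ0]
  | succ r ih =>
    intro hr
    obtain ⟨iA, iQ, iC⟩ := ih (by omega)
    have hrℓ : (r:ℝ) + 1 ≤ ℓ := by exact_mod_cast hr
    have hrδ : ((r:ℝ)+1) * δ ≤ 1 := le_trans (by gcongr) hℓ
    -- average of false
    have hm : ∀ v, ∑ a, N⁻¹ * Fr adj E N r false v a ≤ 1 + (r+1) * δ := by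
      intro v
      have : ∀ a, N⁻¹ * Fr adj E N r false v a ≤ N⁻¹ * (1 + r * δ) + (if a ∈ S then N⁻¹ * Q else 0) := by
        intro a
        by_cases ha : a ∈ S
        · rw [if_pos ha]
          have h1 : 0 ≤ N⁻¹ * (1 + r * δ) := by positivity
          have h2 : N⁻¹ * Fr adj E N r false v a ≤ N⁻¹ * Q := by gcongr; exact iQ v a
          linarith
        · rw [if_neg ha, add_zero]
          gcongr
          exact iC v a ha
      refine (Finset.sum_le_sum fun a _ => this a).trans ?_
      rw [Finset.sum_add_distrib, Finset.sum_const, Finset.card_univ, nsmul_eq_mul, ← hN,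
        ← Finset.sum_filter, Finset.sum_const, nsmul_eq_mul]
      have e1 : N * (N⁻¹ * (1 + r * δ)) = 1 + r * δ := by field_simp
      have e2 : ((univ.filter (fun a => a ∈ S)).card : ℝ) * (N⁻¹ * Q) ≤ δ := by
        have : univ.filter (fun a => a ∈ S) = S := by ext; simp
        rw [this, hδ]
        calc _ ≤ D * (N⁻¹ * Q) := by gcongr
          _ = _ := by field_simp
      rw [e1]; linarith
    have hE0 : 0 ≤ E := by linarith
    have hF0 := Fr_nonneg adj hE0 hN0.le r
    refine ⟨?_, ?_, ?_⟩
    · intro u v huv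
      simp only [Fr]
      have : ∀ a, (if a = u then 0 else if adj v a then (if (true:Bool) then 1 else E) * Fr adj E N r true v a else N⁻¹ * Fr adj E N r false v a)
         ≤ (if a ≠ u ∧ adj v a then (2 * (r:ℝ) + 1) else 0) + N⁻¹ * Fr adj E N r false v a := by
        intro a
        have h1 : 0 ≤ N⁻¹ * Fr adj E N r false v a := mul_nonneg (by positivity) (hF0 _ _ _)
        by_cases h : a = u
        · simp [h] at h1 ⊢; simpa [h] using h1
        · by_cases h' : adj v a
          · simp only [h, h', if_true, if_false, ne_eq, not_false_eq_true, and_self, one_mul]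
            linarith [iA v a h']
          · simp [h, h']
      refine (Finset.sum_le_sum fun a _ => this a).trans ?_
      rw [Finset.sum_add_distrib, ← Finset.sum_filter, Finset.sum_const, nsmul_eq_mul]
      have hc : (univ.filter (fun a => a ≠ u ∧ adj v a)).card ≤ 1 := by
        have h1 : (univ.filter (fun a => a ≠ u ∧ adj v a)) = (univ.filter (fun a => adj v a)).erase u := by
          ext a; simp
        rw [h1, Finset.card_erase_of_mem (by simpa using hsymm u v huv)]
        have := hdeg v
        omega
      have hc' : ((univ.filter (fun a => a ≠ u ∧ adj v a)).card : ℝ) ≤ 1 := by exact_mod_cast hc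
      have : ((univ.filter (fun a => a ≠ u ∧ adj v a)).card : ℝ) * (2 * (r:ℝ) + 1) ≤ 1 * (2 * (r:ℝ) + 1) := by gcongr
      have := hm v
      push_cast
      linarith
    · intro u v
      simp only [Fr]
      have : ∀ a, (if a = u then 0 else if adj v a then (if (false:Bool) then 1 else E) * Fr adj E N r true v a else N⁻¹ * Fr adj E N r false v a)
         ≤ (if adj v a then E * (2 * (ℓ:ℝ) + 1) else 0) + N⁻¹ * Fr adj E N r false v a := by
        intro a
        have h1 : 0 ≤ N⁻¹ * Fr adj E N r false v a := mul_nonneg (by positivity) (hF0 _ _ _)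
        have h2 : 0 ≤ E * (2 * (ℓ:ℝ) + 1) := by positivity
        by_cases h : a = u
        · simp only [h, if_true] at h1 ⊢; split_ifs <;> linarith
        · by_cases h' : adj v a
          · have := iA v a h'
            have : E * Fr adj E N r true v a ≤ E * (2 * (ℓ:ℝ) + 1) := by gcongr; linarith
            simp only [h, h', if_true, if_false, Bool.false_eq_true]
            linarith
          · simp [h, h']
      refine (Finset.sum_le_sum fun a _ => this a).trans ?_
      rw [Finset.sum_add_distrib, ← Finset.sum_filter, Finset.sum_const, nsmul_eq_mul]
      have hc' : ((univ.filter (fun a => adj v a)).card : ℝ) ≤ 2 := by exact_mod_cast hdeg v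
      have : ((univ.filter (fun a => adj v a)).card : ℝ) * (E * (2 * (ℓ:ℝ) + 1)) ≤ 2 * (E * (2 * (ℓ:ℝ) + 1)) := by gcongr
      have := hm v
      linarith
    · intro u v hv
      simp only [Fr]
      have : ∀ a, (if a = u then 0 else if adj v a then (if (false:Bool) then 1 else E) * Fr adj E N r true v a else N⁻¹ * Fr adj E N r false v a)
         ≤ N⁻¹ * Fr adj E N r false v a := by
        intro a
        have h1 : 0 ≤ N⁻¹ * Fr adj E N r false v a := mul_nonneg (by positivity) (hF0 _ _ _)
        have h' : ¬ adj v a := fun h => hv (hS _ _ h)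
        by_cases h : a = u
        · simp only [h, if_true] at h1 ⊢; exact h1
        · simp [h, h']
      refine (Finset.sum_le_sum fun a _ => this a).trans ?_
      push_cast
      exact hm v

open Classical in
lemma Hr_bound {ℓ : ℕ} {D Q δ : ℝ} (hE : 1 ≤ E) (hN : N = Fintype.card V) (hN0 : 0 < N)
    (hsymm : ∀ a b, adj a b → adj b a)
    (S : Finset V) (hS : ∀ a b, adj a b → a ∈ S) (hD : (S.card : ℝ) ≤ D)
    (hdeg : ∀ v, (univ.filter (fun a => adj v a)).card ≤ 2)
    (hQ : Q = 2 * E * (2 * ℓ + 1) + 2) (hδ : δ = D * Q / N) (hℓ : ℓ * δ ≤ 1) (r : ℕ) : r ≤ ℓ →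
    ∑ v, Hr adj E N r v ≤ r * (D * (2 * (E * (2 * ℓ + 1)))) := by
  have hD0 : 0 ≤ D := le_trans (by positivity) hD
  induction r with
  | zero => intro _; simp [Hr]
  | succ r ih =>
    intro hr
    have ih' := ih (by omega)
    have iA := (Fr_bound adj hE hN hN0 hsymm S hS hD hdeg hQ hδ hℓ r (by omega)).1
    have hrℓ : (r:ℝ) + 1 ≤ ℓ := by exact_mod_cast hr
    have hE0 : 0 ≤ E := by linarith
    have hH0 := Hr_nonneg adj hE0 hN0.le r
    have step : ∀ v, Hr adj E N (r+1) v ≤ (if v ∈ S then 2 * (E * (2 * ℓ + 1)) else 0) + N⁻¹ * ∑ a, Hr adj E N r a := by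
      intro v
      simp only [Hr]
      have : ∀ a, (if adj v a then E * Fr adj E N r true v a else N⁻¹ * Hr adj E N r a)
         ≤ (if adj v a then E * (2 * (ℓ:ℝ) + 1) else 0) + N⁻¹ * Hr adj E N r a := by
        intro a
        have h1 : 0 ≤ N⁻¹ * Hr adj E N r a := mul_nonneg (by positivity) (hH0 _)
        by_cases h' : adj v a
        · have := iA v a h'
          have : E * Fr adj E N r true v a ≤ E * (2 * (ℓ:ℝ) + 1) := by gcongr; linarith
          simp only [h', if_true]
          linarith
        · simp [h']
      refine (Finset.sum_le_sum fun a _ => this a).trans ?_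
      rw [Finset.sum_add_distrib, ← Finset.sum_filter, Finset.sum_const, nsmul_eq_mul, ← Finset.mul_sum]
      gcongr
      by_cases hv : v ∈ S
      · rw [if_pos hv]
        have hc' : ((univ.filter (fun a => adj v a)).card : ℝ) ≤ 2 := by exact_mod_cast hdeg v
        gcongr
      · rw [if_neg hv]
        have : univ.filter (fun a => adj v a) = ∅ := by
          ext a; simp; exact fun h => hv (hS _ _ h)
        simp [this]
    refine (Finset.sum_le_sum fun v _ => step v).trans ?_
    rw [Finset.sum_add_distrib, Finset.sum_const, Finset.card_univ, nsmul_eq_mul, ← hN,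
        ← Finset.sum_filter, Finset.sum_const, nsmul_eq_mul]
    have : univ.filter (fun a => a ∈ S) = S := by ext; simp
    rw [this]
    have e1 : N * (N⁻¹ * ∑ a, Hr adj E N r a) = ∑ a, Hr adj E N r a := by field_simp
    rw [e1]
    have : (S.card : ℝ) * (2 * (E * (2 * ℓ + 1))) ≤ D * (2 * (E * (2 * ℓ + 1))) := by gcongr
    push_cast
    linarith

end

lemma edge_inj {n ℓ : ℕ} (γ : Path n ℓ) : Function.Injective γ.edge := by
  intro i j h
  simp only [Path.edge, Sym2.eq_iff] at h
  rcases h with ⟨h, _⟩ | ⟨h, h'⟩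
  · exact Fin.castSucc_injective _ (γ.2 h)
  · have h1 := congrArg Fin.val (γ.2 h)
    have h2 := congrArg Fin.val (γ.2 h')
    simp at h1 h2
    omega


lemma rate_pos {n : ℕ} (hn : 0 < n) : 0 < ((n:ℝ)⁻¹) := by positivity

lemma P_prob {n : ℕ} (hn : 0 < n) : IsProbabilityMeasure (P n) := by
  have := isProbabilityMeasure_expMeasure (rate_pos hn)
  unfold P
  infer_instance

lemma P_indep {n : ℕ} (hn : 0 < n) : iIndepFun (fun (e : Sym2 (Fin n)) (ω : Sym2 (Fin n) → ℝ) => ω e) (P n) := by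
  have := isProbabilityMeasure_expMeasure (rate_pos hn)
  exact iIndepFun_pi (X := fun _ x => x) (fun _ => aemeasurable_id)

lemma P_law {n : ℕ} (hn : 0 < n) {ℓ : ℕ} (γ : Path n ℓ) :
    MeasurePreserving (fun (ω : Sym2 (Fin n) → ℝ) (i : Fin ℓ) => ω (γ.edge i)) (P n)
      (Measure.pi fun _ => expMeasure ((n : ℝ)⁻¹)) := by
  have := isProbabilityMeasure_expMeasure (rate_pos hn)
  have := P_prob hn
  refine ⟨by fun_prop, ?_⟩
  have h := (P_indep hn).precomp (edge_inj γ)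
  have h2 := (iIndepFun_iff_map_fun_eq_pi_map (fun i => (measurable_pi_apply _).aemeasurable)).1 h
  refine h2.trans ?_
  congr 1
  funext i
  exact (measurePreserving_eval (fun _ : Sym2 (Fin n) => expMeasure ((n : ℝ)⁻¹)) (γ.edge i)).map_eq

lemma indep_lint {n : ℕ} (hn : 0 < n) (S : Finset (Sym2 (Fin n))) (f g : (Sym2 (Fin n) → ℝ) → ENNReal)
    (hfm : Measurable f) (hgm : Measurable g)
    (hf : ∀ ω, f (fun e => if e ∈ S then ω e else 0) = f ω)
    (hg : ∀ ω, g (fun e => if e ∈ S then 0 else ω e) = g ω) :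
    ∫⁻ ω, f ω * g ω ∂(P n) = (∫⁻ ω, f ω ∂(P n)) * ∫⁻ ω, g ω ∂(P n) := by
  classical
  apply lintegral_mul_eq_lintegral_mul_lintegral_of_indepFun'' hfm.aemeasurable hgm.aemeasurable
  have h := (P_indep hn).indepFun_finset S Sᶜ disjoint_compl_right (fun i => measurable_pi_apply i)
  have h2 := h.comp (φ := fun y : (S → ℝ) => f (fun e => if he : e ∈ S then y ⟨e, he⟩ else 0))
    (ψ := fun y : ((Sᶜ : Finset _) → ℝ) => g (fun e => if he : e ∈ Sᶜ then y ⟨e, he⟩ else 0))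
    (_mγ := inferInstance) (_mγ' := inferInstance) ?_ ?_
  · convert! h2 using 1
    · funext ω
      simp only [Function.comp]
      rw [← hf ω]
      simp
    · funext ω
      simp only [Function.comp]
      rw [← hg ω]
      congr 1
      funext e
      by_cases he : e ∈ S <;> simp [he]
  · apply hfm.comp
    apply measurable_pi_lambda
    intro e
    by_cases he : e ∈ S
    · simp only [he, dite_true]; fun_prop
    · simp only [he, dite_false]; fun_prop
  · apply hgm.comp
    apply measurable_pi_lambda
    intro e
    by_cases he : e ∈ Sᶜ
    · simp only [he, dite_true]; fun_prop
    · simp only [he, dite_false]; fun_prop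

lemma exp_tilt {n : ℕ} (hn : 0 < n) {lam : ℝ} (hl : 0 < lam) :
    ∫⁻ x, ENNReal.ofReal (Real.exp (-(x / lam - 1))) ∂(expMeasure ((n : ℝ)⁻¹)) ≤
      ENNReal.ofReal (Real.exp 1 * lam * (n:ℝ)⁻¹) := by
  have : ∀ x : ℝ, ENNReal.ofReal (Real.exp (-(x / lam - 1))) =
      ENNReal.ofReal (Real.exp 1) * ENNReal.ofReal (Real.exp (-(lam⁻¹ * x))) := by
    intro x
    rw [← ENNReal.ofReal_mul (by positivity), ← Real.exp_add]
    congr 2; field_simp; ring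
  simp_rw [this]
  rw [lintegral_const_mul' _ _ ENNReal.ofReal_ne_top, exp_laplace (rate_pos hn) (by positivity),
    ← ENNReal.ofReal_mul (by positivity)]
  apply ENNReal.ofReal_le_ofReal
  rw [mul_assoc]
  gcongr
  have h := rate_pos hn
  rw [div_le_iff₀ (by positivity)]
  have : lam * (n:ℝ)⁻¹ * ((n:ℝ)⁻¹ + lam⁻¹) = lam * (n:ℝ)⁻¹ * (n:ℝ)⁻¹ + (n:ℝ)⁻¹ := by
    field_simp
  rw [this]
  have : 0 ≤ lam * (n:ℝ)⁻¹ * (n:ℝ)⁻¹ := by positivity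
  linarith

lemma prod_tilt {n : ℕ} (hn : 0 < n) {ℓ : ℕ} (γ : Path n ℓ) {lam : ℝ} (hl : 0 < lam) (s : Fin ℓ → Bool) :
    ∫⁻ ω, ∏ i, (if s i then 1 else ENNReal.ofReal (Real.exp (-(ω (γ.edge i) / lam - 1)))) ∂(P n) ≤
      ∏ i, (if s i then 1 else ENNReal.ofReal (Real.exp 1 * lam * (n:ℝ)⁻¹)) := by
  have := P_prob hn
  have h1 : iIndepFun (fun (i : Fin ℓ) (ω : Sym2 (Fin n) → ℝ) =>
      (if s i then (1:ENNReal) else ENNReal.ofReal (Real.exp (-(ω (γ.edge i) / lam - 1))))) (P n) := by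
    refine ((P_indep hn).precomp (edge_inj γ)).comp
      (fun i x => (if s i then (1:ENNReal) else ENNReal.ofReal (Real.exp (-(x / lam - 1))))) ?_
    intro i
    split_ifs <;> fun_prop
  rw [lintegral_prod_eq_prod_lintegral_of_indepFun _ _ h1]
  · apply Finset.prod_le_prod'
    intro i _
    split_ifs
    · simp
    · have := isProbabilityMeasure_expMeasure (rate_pos hn)
      have hp := measurePreserving_eval (fun _ : Sym2 (Fin n) => expMeasure ((n : ℝ)⁻¹)) (γ.edge i)
      have hc := hp.lintegral_comp (f := fun x => ENNReal.ofReal (Real.exp (-(x / lam - 1)))) (by fun_prop)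
      exact hc.trans_le (exp_tilt hn hl)
  · intro i
    split_ifs <;> fun_prop

/-- Chernoff -/
lemma chernoff {n : ℕ} (hn : 0 < n) {ℓ : ℕ} (γ : Path n ℓ) {lam : ℝ} (hl : 0 < lam) :
    P n {ω | weight ω γ ≤ lam * ℓ} ≤ ENNReal.ofReal (Real.exp 1 * lam * (n:ℝ)⁻¹) ^ ℓ := by
  have h := prod_tilt hn γ hl (fun _ => false)
  simp only [Bool.false_eq_true, if_false, Finset.prod_const, Finset.card_univ, Fintype.card_fin] at h
  refine le_trans ?_ h
  have hm : MeasurableSet {ω : Sym2 (Fin n) → ℝ | weight ω γ ≤ lam * ℓ} := by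
    unfold weight
    exact measurableSet_le (by fun_prop) (by fun_prop)
  rw [← lintegral_indicator_one hm]
  apply lintegral_mono
  intro ω
  by_cases hω : ω ∈ {ω : Sym2 (Fin n) → ℝ | weight ω γ ≤ lam * ℓ}
  · rw [Set.indicator_of_mem hω]
    beta_reduce
    rw [← ENNReal.ofReal_prod_of_nonneg (fun _ _ => by positivity), ← Real.exp_sum]
    simp only [Pi.one_apply, ENNReal.one_le_ofReal, Real.one_le_exp_iff]
    have h2 : weight ω γ ≤ lam * ℓ := hω
    unfold weight at h2
    rw [Finset.sum_neg_distrib, Finset.sum_sub_distrib, ← Finset.sum_div]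
    simp only [Finset.sum_const, Finset.card_univ, Fintype.card_fin, nsmul_eq_mul, mul_one]
    have : (∑ i, ω (γ.edge i)) / lam ≤ ℓ := by rw [div_le_iff₀ hl]; linarith
    linarith
  · rw [Set.indicator_of_notMem hω]; exact zero_le

/-- The good event for a path. -/
def A (B lam t : ℝ) {n ℓ : ℕ} (γ : Path n ℓ) : Set (Sym2 (Fin n) → ℝ) :=
  {ω | W B lam ℓ t (fun i => ω (γ.edge i))}

lemma A_meas {n : ℕ} (B lam t : ℝ) {ℓ : ℕ} (γ : Path n ℓ) : MeasurableSet (A B lam t γ) := by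
  have : Measurable (fun (ω : Sym2 (Fin n) → ℝ) (i : Fin ℓ) => ω (γ.edge i)) := by fun_prop
  exact this (W_meas' B lam ℓ t)

lemma P_A {n : ℕ} (hn : 0 < n) (B lam t : ℝ) {ℓ : ℕ} (γ : Path n ℓ) :
    P n (A B lam t γ) = (Measure.pi fun _ : Fin ℓ => expMeasure ((n : ℝ)⁻¹)) {x | W B lam ℓ t x} :=
  (P_law hn γ).measure_preimage (W_meas' B lam ℓ t).nullMeasurableSet

open Classical in
lemma A_dep {n : ℕ} (B lam t : ℝ) {ℓ : ℕ} (γ : Path n ℓ) (ω ω' : Sym2 (Fin n) → ℝ)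
    (h : ∀ i, ω (γ.edge i) = ω' (γ.edge i)) :
    (A B lam t γ).indicator (1 : (Sym2 (Fin n) → ℝ) → ENNReal) ω = (A B lam t γ).indicator 1 ω' := by
  have : ω ∈ A B lam t γ ↔ ω' ∈ A B lam t γ := by
    change W _ _ _ _ _ ↔ W _ _ _ _ _
    simp only [h]
  by_cases h1 : ω ∈ A B lam t γ
  · simp [h1, this.1 h1]
  · have h2 : ω' ∉ A B lam t γ := fun h2 => h1 (this.2 h2)
    simp [h1, h2]

lemma P_A_disj {n : ℕ} (hn : 0 < n) (B lam t : ℝ) {ℓ : ℕ} (γ γ' : Path n ℓ) (hd : ∀ i, γ'.edge i ∉ Set.range γ.edge) :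
    P n (A B lam t γ ∩ A B lam t γ') = P n (A B lam t γ) * P n (A B lam t γ') := by
  classical
  have hm := A_meas B lam t γ
  have hm' := A_meas B lam t γ'
  rw [← lintegral_indicator_one (hm.inter hm'), ← lintegral_indicator_one hm, ← lintegral_indicator_one hm']
  rw [← indep_lint hn (univ.image γ.edge)]
  · congr 1
    funext ω
    rw [Set.inter_indicator_one]
    rfl
  · exact measurable_one.indicator hm
  · exact measurable_one.indicator hm'
  · intro ω
    apply A_dep
    intro i
    simp
  · intro ω
    apply A_dep
    intro i
    rw [if_neg]
    simpa using hd i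

/-- edge relation of a path -/
def padj {n ℓ : ℕ} (γ : Path n ℓ) (a b : Fin n) : Prop := s(a, b) ∈ Set.range γ.edge

lemma P_A_pair {n : ℕ} (hn : 0 < n) {B lam : ℝ} (hl : 0 < lam) (hle : Real.exp 1 * lam ≤ 1) (hB : 1 ≤ B) {ℓ : ℕ} (γ γ' : Path n ℓ) :
    P n (A B lam (B-1) γ ∩ A B lam (B-1) γ') ≤ P n (A B lam (B-1) γ) *
      ENNReal.ofReal (Real.exp 1 * cost (Real.exp B) ℓ false (sh (padj γ) γ'.1) (fun _ => (n:ℝ)⁻¹)) := by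
  classical
  set s := sh (padj γ) γ'.1 with hs
  have hm := A_meas B lam (B-1) γ
  have hm' := A_meas B lam (B-1) γ'
  set K := ENNReal.ofReal (Real.exp 1 * (Real.exp B) ^ (st ℓ false s)) with hK
  set g : (Sym2 (Fin n) → ℝ) → ENNReal := fun ω =>
    ∏ i, (if s i then 1 else ENNReal.ofReal (Real.exp (-(ω (γ'.edge i) / lam - 1)))) with hg
  have hgm : Measurable g := by
    rw [hg]
    apply Finset.measurable_prod
    intro i _
    split_ifs <;> fun_prop
  rw [← lintegral_indicator_one (hm.inter hm')]
  calc _ ≤ ∫⁻ ω, K * ((A B lam (B-1) γ).indicator 1 ω * g ω) ∂(P n) := by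
        apply lintegral_mono
        intro ω
        rw [Set.inter_indicator_one]
        simp only [Pi.mul_apply]
        rw [mul_left_comm]
        gcongr
        by_cases hω : ω ∈ A B lam (B-1) γ'
        · rw [Set.indicator_of_mem hω]
          have h1 := W_sum ℓ (B-1) false s _ (by linarith) (by linarith) hω
          have h2 : g ω = ENNReal.ofReal (Real.exp (-∑ i, (if s i then 0 else (ω (γ'.edge i) / lam - 1)))) := by
            rw [← Finset.sum_neg_distrib, Real.exp_sum, ENNReal.ofReal_prod_of_nonneg (fun _ _ => by positivity)]
            apply Finset.prod_congr rfl
            intro i _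
            split_ifs <;> simp
          rw [h2, hK, ← ENNReal.ofReal_mul (by positivity), ← Real.exp_nat_mul, ← Real.exp_add, ← Real.exp_add]
          simp only [Pi.one_apply, ENNReal.one_le_ofReal, Real.one_le_exp_iff]
          simp at h1
          linarith
        · rw [Set.indicator_of_notMem hω]; exact zero_le
    _ = K * ((∫⁻ ω, (A B lam (B-1) γ).indicator 1 ω ∂(P n)) * ∫⁻ ω, g ω ∂(P n)) := by
        rw [lintegral_const_mul' _ _ ENNReal.ofReal_ne_top]
        congr 1
        apply indep_lint hn (univ.image γ.edge)
        · exact measurable_one.indicator hm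
        · exact hgm
        · intro ω
          apply A_dep
          intro i
          simp
        · intro ω
          simp only [hg]
          apply Finset.prod_congr rfl
          intro i _
          by_cases hi : s i = true
          · simp [hi]
          · have : γ'.edge i ∉ univ.image γ.edge := by
              intro h
              apply hi
              simp only [hs, sh, decide_eq_true_eq]
              obtain ⟨a, _, ha⟩ := Finset.mem_image.1 h
              exact ⟨a, ha⟩
            simp only [this, if_false]
    _ = P n (A B lam (B-1) γ) * (K * ∫⁻ ω, g ω ∂(P n)) := by
        rw [lintegral_indicator_one hm]; ring
    _ ≤ _ := by
        gcongr
        calc _ ≤ K * ∏ i, (if s i then 1 else ENNReal.ofReal (Real.exp 1 * lam * (n:ℝ)⁻¹)) := by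
              gcongr
              exact prod_tilt hn γ' hl s
          _ ≤ K * ∏ i, (if s i then 1 else ENNReal.ofReal ((n:ℝ)⁻¹)) := by
              gcongr
              split_ifs
              · exact le_rfl
              · apply ENNReal.ofReal_le_ofReal
                have := rate_pos hn
                nlinarith
          _ = _ := by
              unfold cost
              rw [hK, ← mul_assoc, ENNReal.ofReal_mul (by positivity), ENNReal.ofReal_mul (by positivity),
                ENNReal.ofReal_mul (by positivity), ENNReal.ofReal_prod_of_nonneg]
              · congr 1
                apply Finset.prod_congr rfl
                intro i _
                split_ifs <;> simp
              · intro i _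
                split_ifs <;> positivity

lemma second_moment {Ω ι : Type*} [MeasurableSpace Ω] [Fintype ι] (μ : Measure Ω) [IsProbabilityMeasure μ]
    (S : ι → Set Ω) (hS : ∀ i, MeasurableSet (S i)) (p K : ℝ) (hp : ∀ i, μ.real (S i) = p)
    (h2 : ∀ i, ∑ j, μ.real (S i ∩ S j) ≤ p * (Fintype.card ι * p + K)) :
    (Fintype.card ι * p)^2 * μ.real (⋃ i, S i)ᶜ ≤ Fintype.card ι * p * K := by
  set m : ℝ := (Fintype.card ι : ℝ) with hm
  set X : Ω → ℝ := fun ω => ∑ i, (S i).indicator 1 ω with hX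
  have hint : ∀ T : Set Ω, MeasurableSet T → Integrable (T.indicator (1 : Ω → ℝ)) μ := by
    intro T hT
    exact (integrable_const (1:ℝ)).indicator hT
  have hXi : Integrable X μ := integrable_finsetSum _ (fun i _ => hint _ (hS i))
  have hXX : ∀ ω, X ω * X ω = ∑ i, ∑ j, (S i ∩ S j).indicator (1 : Ω → ℝ) ω := by
    intro ω
    rw [hX, Finset.sum_mul_sum]
    refine Finset.sum_congr rfl fun i _ => Finset.sum_congr rfl fun j _ => ?_
    rw [Set.inter_indicator_one]; rfl
  have hXXi : Integrable (fun ω => X ω * X ω) μ := by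
    simp_rw [hXX]
    exact integrable_finsetSum _ (fun i _ => integrable_finsetSum _ (fun j _ => hint _ ((hS i).inter (hS j))))
  have e1 : ∫ ω, X ω ∂μ = m * p := by
    rw [hX, integral_finsetSum _ (fun i _ => hint _ (hS i))]
    simp_rw [integral_indicator_one (hS _), hp]
    simp [hm]
  have e2 : ∫ ω, X ω * X ω ∂μ ≤ m * (p * (m * p + K)) := by
    simp_rw [hXX]
    rw [integral_finsetSum _ (fun i _ => integrable_finsetSum _ (fun j _ => hint _ ((hS i).inter (hS j))))]
    calc _ = ∑ i, ∑ j, μ.real (S i ∩ S j) := by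
          refine Finset.sum_congr rfl fun i _ => ?_
          rw [integral_finsetSum _ (fun j _ => hint _ ((hS i).inter (hS j)))]
          refine Finset.sum_congr rfl fun j _ => ?_
          exact integral_indicator_one ((hS i).inter (hS j))
      _ ≤ ∑ i : ι, p * (m * p + K) := Finset.sum_le_sum fun i _ => h2 i
      _ = _ := by simp [hm]
  set T := (⋃ i, S i)ᶜ with hT
  have hTm : MeasurableSet T := (MeasurableSet.iUnion hS).compl
  have e3 : ∫ ω, (m*p)^2 * T.indicator (1 : Ω → ℝ) ω ∂μ ≤ ∫ ω, (X ω * X ω - 2 * (m*p) * X ω + (m*p)^2) ∂μ := by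
    apply integral_mono ((hint T hTm).const_mul _)
    · exact (hXXi.sub (hXi.const_mul _)).add (integrable_const _)
    · intro ω
      beta_reduce
      by_cases hω : ω ∈ T
      · have : X ω = 0 := by
          rw [hX]
          apply Finset.sum_eq_zero
          intro i _
          apply Set.indicator_of_notMem
          intro h
          exact hω (Set.mem_iUnion.2 ⟨i, h⟩)
        rw [this, Set.indicator_of_mem hω]; simp
      · rw [Set.indicator_of_notMem hω]
        nlinarith [sq_nonneg (X ω - m * p)]
  rw [integral_const_mul, integral_indicator_one hTm] at e3
  have hi : Integrable (fun ω => X ω * X ω - 2 * (m*p) * X ω) μ := hXXi.sub (hXi.const_mul _)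
  rw [integral_add hi (integrable_const _), integral_sub hXXi (hXi.const_mul _),
    integral_const_mul, e1] at e3
  simp only [integral_const, probReal_univ, one_smul] at e3
  linarith

lemma padj_symm {n ℓ : ℕ} (γ : Path n ℓ) (a b : Fin n) (h : padj γ a b) : padj γ b a := by
  unfold padj at *; rwa [Sym2.eq_swap]

open Classical in
lemma padj_mem {n ℓ : ℕ} (γ : Path n ℓ) (a b : Fin n) (h : padj γ a b) : a ∈ univ.image γ.1 := by
  obtain ⟨i, hi⟩ := h
  simp only [Path.edge, Sym2.eq_iff] at hi
  rcases hi with ⟨h, _⟩ | ⟨_, h⟩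
  · exact Finset.mem_image.2 ⟨_, mem_univ _, h⟩
  · exact Finset.mem_image.2 ⟨_, mem_univ _, h⟩

open Classical in
lemma padj_deg {n ℓ : ℕ} (γ : Path n ℓ) (v : Fin n) : (univ.filter (fun a => padj γ v a)).card ≤ 2 := by
  by_cases hv : ∃ k, γ.1 k = v
  · obtain ⟨k, rfl⟩ := hv
    have hsub : univ.filter (fun a => padj γ (γ.1 k) a) ⊆
        {γ.1 (Fin.ofNat (ℓ+1) (k.val + 1)), γ.1 (Fin.ofNat (ℓ+1) (k.val - 1))} := by
      intro a ha
      obtain ⟨i, hi⟩ := (Finset.mem_filter.1 ha).2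
      simp only [Path.edge, Sym2.eq_iff] at hi
      simp only [Finset.mem_insert, Finset.mem_singleton]
      rcases hi with ⟨h, h'⟩ | ⟨h, h'⟩
      · left
        rw [← h', ← γ.2 h]
        refine congrArg γ.1 (Fin.ext ?_)
        simp only [Fin.val_succ, Fin.val_castSucc, Fin.val_ofNat]
        rw [Nat.mod_eq_of_lt (by omega)]
      · right
        rw [← h, ← γ.2 h']
        refine congrArg γ.1 (Fin.ext ?_)
        simp only [Fin.val_succ, Fin.val_castSucc, Fin.val_ofNat]
        rw [Nat.mod_eq_of_lt (by omega)]; omega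
    exact (Finset.card_le_card hsub).trans Finset.card_le_two
  · rw [Finset.filter_eq_empty_iff.2]
    · simp
    · intro a _ h
      obtain ⟨k, _, hk⟩ := Finset.mem_image.1 (padj_mem γ v a h)
      exact hv ⟨k, hk⟩

open Classical in
lemma share_sum {n ℓ : ℕ} (hn : 0 < n) (γ : Path n ℓ) {E : ℝ} (hE : 1 ≤ E)
    (hδ : (ℓ:ℝ) * ((ℓ + 1) * (2 * E * (2 * ℓ + 1) + 2) / n) ≤ 1) :
    ∑ γ' : Path n ℓ, (if (∃ i, sh (padj γ) γ'.1 i = true) then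
      cost E ℓ false (sh (padj γ) γ'.1) (fun _ => (n:ℝ)⁻¹) else 0) ≤
      ℓ * ((ℓ + 1) * (2 * (E * (2 * ℓ + 1)))) := by
  have hn' : (0:ℝ) < n := by exact_mod_cast hn
  have h1 := Hr_bound (padj γ) (ℓ := ℓ) (D := ℓ + 1) hE (N := n) (by simp) hn' (padj_symm γ)
    (univ.image γ.1) (padj_mem γ)
    (by exact_mod_cast (Finset.card_image_le.trans (by simp))) (padj_deg γ) rfl rfl hδ ℓ le_rfl
  refine le_trans ?_ h1
  have h2 : ∀ v, _ := sum_le_Hr (padj γ) (E := E) (N := n) (by linarith) hn'.le ℓ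
  refine le_trans ?_ (Finset.sum_le_sum (fun v _ => h2 v))
  refine le_trans (b := ∑ w : Fin (ℓ+1) → Fin n, if Function.Injective w ∧ (∃ i, sh (padj γ) w i = true) then
      cost E ℓ false (sh (padj γ) w) (fun _ => (n:ℝ)⁻¹) else 0) ?_ (le_of_eq ?_)
  swap
  · rw [sum_cons]
    congr!
  rw [← Finset.sum_filter_add_sum_filter_not univ (fun w : Fin (ℓ+1) → Fin n => Function.Injective w)]
  rw [Finset.sum_subtype (p := Function.Injective) (univ.filter _) (by simp)]
  apply le_of_eq
  rw [Finset.sum_eq_zero (s := univ.filter _), add_zero]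
  · apply Finset.sum_congr rfl
    intro x _
    simp [x.2]
  · intro x hx
    rw [if_neg]
    rintro ⟨h, _⟩
    exact (Finset.mem_filter.1 hx).2 h

lemma pair_sum {n ℓ : ℕ} (hn : 0 < n) {B lam : ℝ} (hl : 0 < lam) (hle : Real.exp 1 * lam ≤ 1) (hB : 1 ≤ B)
    (hδ : (ℓ:ℝ) * ((ℓ + 1) * (2 * Real.exp B * (2 * ℓ + 1) + 2) / n) ≤ 1) (p : ℝ)
    (hp : ∀ γ : Path n ℓ, (P n).real (A B lam (B-1) γ) = p) (γ : Path n ℓ) :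
    ∑ γ' : Path n ℓ, (P n).real (A B lam (B-1) γ ∩ A B lam (B-1) γ') ≤
      p * (Fintype.card (Path n ℓ) * p + Real.exp 1 * (ℓ * ((ℓ + 1) * (2 * (Real.exp B * (2 * ℓ + 1)))))) := by
  classical
  have := P_prob hn
  have hp0 : 0 ≤ p := by rw [← hp γ]; positivity
  have hE : 1 ≤ Real.exp B := Real.one_le_exp (by linarith)
  have hc : ∀ γ' : Path n ℓ, 0 ≤ cost (Real.exp B) ℓ false (sh (padj γ) γ'.1) (fun _ => (n:ℝ)⁻¹) := by
    intro γ'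
    unfold cost
    apply mul_nonneg (by positivity)
    apply Finset.prod_nonneg
    intro i _
    split_ifs <;> positivity
  have key : ∀ γ' : Path n ℓ, (P n).real (A B lam (B-1) γ ∩ A B lam (B-1) γ') ≤
      p * p + p * Real.exp 1 * (if (∃ i, sh (padj γ) γ'.1 i = true) then
      cost (Real.exp B) ℓ false (sh (padj γ) γ'.1) (fun _ => (n:ℝ)⁻¹) else 0) := by
    intro γ'
    split_ifs with h
    · have h1 := P_A_pair hn hl hle hB γ γ'
      have h2 := ENNReal.toReal_mono (ENNReal.mul_ne_top (measure_ne_top _ _) ENNReal.ofReal_ne_top) h1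
      rw [ENNReal.toReal_mul, ENNReal.toReal_ofReal (mul_nonneg (by positivity) (hc γ'))] at h2
      change (P n).real _ ≤ (P n).real _ * _ at h2
      rw [hp] at h2
      nlinarith
    · have h1 := P_A_disj hn B lam (B-1) γ γ' (by
        intro i hi
        apply h
        refine ⟨i, ?_⟩
        simp only [sh, decide_eq_true_eq]
        exact hi)
      have h2 := congrArg ENNReal.toReal h1
      rw [ENNReal.toReal_mul] at h2
      change (P n).real _ = (P n).real _ * (P n).real _ at h2
      rw [hp, hp] at h2
      rw [h2]; simp
  calc _ ≤ _ := Finset.sum_le_sum fun γ' _ => key γ'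
    _ = Fintype.card (Path n ℓ) * (p * p) + p * Real.exp 1 * ∑ γ' : Path n ℓ, (if (∃ i, sh (padj γ) γ'.1 i = true) then
      cost (Real.exp B) ℓ false (sh (padj γ) γ'.1) (fun _ => (n:ℝ)⁻¹) else 0) := by
        rw [Finset.sum_add_distrib, Finset.sum_const, Finset.card_univ, nsmul_eq_mul, ← Finset.mul_sum]
    _ ≤ Fintype.card (Path n ℓ) * (p * p) + p * Real.exp 1 * (ℓ * ((ℓ + 1) * (2 * (Real.exp B * (2 * ℓ + 1))))) := by
        gcongr
        exact share_sum hn γ hE hδ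
    _ = _ := by ring

lemma card_path (n ℓ : ℕ) : Fintype.card (Path n ℓ) = n.descFactorial (ℓ+1) := by
  classical
  rw [Fintype.card_congr (Equiv.subtypeInjectiveEquivEmbedding (Fin (ℓ+1)) (Fin n)), Fintype.card_embedding_eq]
  simp

lemma card_path_le (n ℓ : ℕ) : Fintype.card (Path n ℓ) ≤ n^(ℓ+1) := by
  rw [card_path]; exact Nat.descFactorial_le_pow _ _

lemma card_path_ge (n ℓ : ℕ) (h : 2 * (ℓ * (ℓ+1)) ≤ n) (hn : 0 < n) :
    (n:ℝ)^(ℓ+1) / 2 ≤ Fintype.card (Path n ℓ) := by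
  rw [card_path]
  have h1 := Nat.pow_sub_le_descFactorial n (ℓ+1)
  have hl : ℓ ≤ n := by nlinarith
  have h2 : ((n:ℝ) - ℓ)^(ℓ+1) ≤ n.descFactorial (ℓ+1) := by
    have : n + 1 - (ℓ + 1) = n - ℓ := by omega
    rw [this] at h1
    have h3 : (((n - ℓ)^(ℓ+1) : ℕ):ℝ) ≤ n.descFactorial (ℓ+1) := by exact_mod_cast h1
    push_cast [Nat.cast_sub hl] at h3
    exact h3
  refine le_trans ?_ h2
  have hn' : (0:ℝ) < n := by exact_mod_cast hn
  have h4 := one_add_mul_le_pow (a := -(ℓ:ℝ)/n) (by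
    rw [neg_div, neg_le_neg_iff, div_le_iff₀ hn']
    have : (ℓ:ℝ) ≤ n := by exact_mod_cast hl
    linarith) (ℓ+1)
  have h5 : ((n:ℝ) - ℓ)^(ℓ+1) = n^(ℓ+1) * (1 + -(ℓ:ℝ)/n)^(ℓ+1) := by
    rw [← mul_pow]; congr 1; field_simp; ring
  rw [h5, div_eq_mul_inv]
  gcongr
  refine le_trans ?_ h4
  have h6 : (2 * (ℓ * (ℓ+1)) : ℝ) ≤ n := by exact_mod_cast h
  have h7 : (ℓ:ℝ) * (ℓ+1) / n ≤ 1/2 := by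
    rw [div_le_iff₀ hn']; linarith
  have h8 : ((ℓ+1 : ℕ):ℝ) * (-(ℓ:ℝ)/n) = -((ℓ:ℝ) * (ℓ+1) / n) := by push_cast; ring
  rw [h8]; norm_num at *; linarith

lemma path_lt {n ℓ : ℕ} (γ : Path n ℓ) : ℓ < n := by
  have := Fintype.card_le_of_injective _ γ.2
  simp at this
  omega

lemma L_bdd (n : ℕ) (lam : ℝ) (ω : Sym2 (Fin n) → ℝ) :
    BddAbove {ℓ : ℕ | ∃ γ : Path n ℓ, weight ω γ ≤ lam * ℓ} :=
  ⟨n, fun _ ⟨γ, _⟩ => (path_lt γ).le⟩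

lemma le_L {n ℓ : ℕ} {lam : ℝ} {ω : Sym2 (Fin n) → ℝ} (γ : Path n ℓ) (h : weight ω γ ≤ lam * ℓ) :
    ℓ ≤ L n lam ω := le_csSup (L_bdd n lam ω) ⟨γ, h⟩

lemma L_spec {n : ℕ} (hn : 0 < n) (lam : ℝ) (ω : Sym2 (Fin n) → ℝ) :
    ∃ γ : Path n (L n lam ω), weight ω γ ≤ lam * (L n lam ω : ℕ) := by
  have : L n lam ω ∈ {ℓ : ℕ | ∃ γ : Path n ℓ, weight ω γ ≤ lam * ℓ} := by
    apply Nat.sSup_mem _ (L_bdd n lam ω)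
    refine ⟨0, ⟨fun _ => ⟨0, hn⟩, fun a b _ => Subsingleton.elim (α := Fin 1) a b⟩, ?_⟩
    simp [weight]
  exact this

lemma upper_len {n : ℕ} (hn : 0 < n) {lam : ℝ} (hl : 0 < lam) (ℓ : ℕ) :
    P n {ω | ∃ γ : Path n ℓ, weight ω γ ≤ lam * ℓ} ≤ ENNReal.ofReal (n * (Real.exp 1 * lam)^ℓ) := by
  have hn' : (0:ℝ) < n := by exact_mod_cast hn
  calc _ = P n (⋃ γ : Path n ℓ, {ω | weight ω γ ≤ lam * ℓ}) := by
        congr 1; ext ω; simp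
    _ ≤ ∑ γ : Path n ℓ, P n {ω | weight ω γ ≤ lam * ℓ} := measure_iUnion_fintype_le _ _
    _ ≤ ∑ γ : Path n ℓ, ENNReal.ofReal (Real.exp 1 * lam * (n:ℝ)⁻¹) ^ ℓ :=
        Finset.sum_le_sum fun γ _ => chernoff hn γ hl
    _ = (Fintype.card (Path n ℓ) : ENNReal) * ENNReal.ofReal (Real.exp 1 * lam * (n:ℝ)⁻¹) ^ ℓ := by
        rw [Finset.sum_const, Finset.card_univ, nsmul_eq_mul]
    _ ≤ ((n^(ℓ+1) : ℕ) : ENNReal) * ENNReal.ofReal (Real.exp 1 * lam * (n:ℝ)⁻¹) ^ ℓ := by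
        gcongr; exact card_path_le n ℓ
    _ = _ := by
        rw [← ENNReal.ofReal_natCast, ← ENNReal.ofReal_pow (by positivity), ← ENNReal.ofReal_mul (by positivity)]
        congr 1
        rw [mul_pow _ ((n:ℝ)⁻¹)]
        push_cast
        rw [pow_succ, inv_pow]
        field_simp

lemma upper {n : ℕ} (hn : 0 < n) {lam : ℝ} (hl : 0 < lam) (hε : 0 < Real.exp (-1) - lam) :
    P n {ω | ¬ (L n lam ω : ℝ) ≤ 2 * (Real.exp (-1) - lam)⁻¹ * Real.log n} ≤
      ENNReal.ofReal (Real.exp (-2 * Real.log n)) := by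
  have hn' : (0:ℝ) < n := by exact_mod_cast hn
  set ε := Real.exp (-1) - lam with hεd
  set T := 2 * ε⁻¹ * Real.log n with hT
  have he : Real.exp 1 * lam ≤ Real.exp (-(2 * ε)) := by
    have h1 : Real.exp 1 * lam = 1 - Real.exp 1 * ε := by
      rw [hεd, mul_sub, ← Real.exp_add]; simp
    have h2 := Real.add_one_le_exp (-(2*ε))
    have h3 : (2:ℝ) ≤ Real.exp 1 := by have := Real.add_one_le_exp (1:ℝ); linarith
    rw [h1]; nlinarith
  have hlen : ∀ ℓ : ℕ, T < ℓ → (Real.exp 1 * lam)^ℓ ≤ Real.exp (-4 * Real.log n) := by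
    intro ℓ hℓ
    calc _ ≤ (Real.exp (-(2*ε)))^ℓ := by gcongr
      _ = Real.exp (ℓ * (-(2*ε))) := by rw [← Real.exp_nat_mul]
      _ ≤ _ := by
        apply Real.exp_le_exp.2
        have : T * (2 * ε) = 4 * Real.log n := by rw [hT]; field_simp; ring
        nlinarith
  have hsub : {ω | ¬ (L n lam ω : ℝ) ≤ T} ⊆
      ⋃ ℓ ∈ (range n).filter (fun ℓ : ℕ => T < ℓ), {ω | ∃ γ : Path n ℓ, weight ω γ ≤ lam * ℓ} := by
    intro ω hω
    obtain ⟨γ, hγ⟩ := L_spec hn lam ω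
    have h3 : T < (L n lam ω : ℝ) := not_le.1 hω
    exact Set.mem_biUnion (x := L n lam ω) (by
      simp only [Finset.coe_filter]
      exact ⟨Finset.mem_range.2 (path_lt γ), h3⟩) ⟨γ, hγ⟩
  calc _ ≤ _ := measure_mono hsub
    _ ≤ ∑ ℓ ∈ (range n).filter (fun ℓ : ℕ => T < ℓ), P n {ω | ∃ γ : Path n ℓ, weight ω γ ≤ lam * ℓ} :=
        measure_biUnion_finset_le _ _
    _ ≤ ∑ ℓ ∈ (range n).filter (fun ℓ : ℕ => T < ℓ), ENNReal.ofReal (n * Real.exp (-4 * Real.log n)) := by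
        apply Finset.sum_le_sum
        intro ℓ hℓ
        refine (upper_len hn hl ℓ).trans (ENNReal.ofReal_le_ofReal ?_)
        gcongr
        exact hlen ℓ (Finset.mem_filter.1 hℓ).2
    _ ≤ ∑ ℓ ∈ range n, ENNReal.ofReal (n * Real.exp (-4 * Real.log n)) :=
        Finset.sum_le_sum_of_subset (Finset.filter_subset _ _)
    _ = ENNReal.ofReal (n * (n * Real.exp (-4 * Real.log n))) := by
        rw [Finset.sum_const, Finset.card_range, nsmul_eq_mul,
          ENNReal.ofReal_mul (p := (n:ℝ)) (q := n * Real.exp (-4 * Real.log n)) (by positivity),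
          ENNReal.ofReal_natCast]
    _ = _ := by
        congr 1
        nth_rewrite 1 [← Real.exp_log hn']
        nth_rewrite 2 [← Real.exp_log hn']
        rw [← Real.exp_add, ← Real.exp_add]
        congr 1; ring

set_option maxHeartbeats 1000000 in
lemma lower_gen {n ℓ : ℕ} (hn : 0 < n) {B lam : ℝ} (hl : 0 < lam) (hle : Real.exp 1 * lam ≤ 1) (hB : Real.pi ≤ B)
    (hδ : (ℓ:ℝ) * ((ℓ + 1) * (2 * Real.exp B * (2 * ℓ + 1) + 2) / n) ≤ 1)
    (h2 : 2 * (ℓ * (ℓ+1)) ≤ n) {q : ℝ} (hq0 : 0 < q)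
    (hq : q ≤ (n:ℝ) / 2 * (Real.exp 1 * lam)^ℓ * Real.exp (-1) * Real.exp (-((Real.pi / B)^2 * ℓ)) *
      (Real.pi / B / 2) * Real.exp (-B)) :
    P n (⋃ γ : Path n ℓ, A B lam (B-1) γ)ᶜ ≤ ENNReal.ofReal
      (Real.exp 1 * (ℓ * ((ℓ + 1) * (2 * (Real.exp B * (2 * ℓ + 1))))) / q) := by
  have hn' : (0:ℝ) < n := by exact_mod_cast hn
  have hn1 : (1:ℝ) ≤ n := by exact_mod_cast hn
  have := P_prob hn
  have hpi := Real.pi_gt_three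
  have hB1 : 1 ≤ B := by linarith
  have hB0 : 0 < B := by linarith
  set β := Real.pi / B with hβ
  have hβ0 : 0 < β := by positivity
  have hβ1 : β ≤ 1 := by rw [hβ, div_le_one hB0]; exact hB
  have hβB : Real.pi / β = B := by rw [hβ]; field_simp
  have hlam1 : lam ≤ 1 := by
    have := Real.add_one_le_exp (1:ℝ); nlinarith
  set r : ℝ := (n:ℝ)⁻¹ with hr
  have hr0 : 0 < r := by positivity
  have hr1 : r ≤ 1 := inv_le_one_of_one_le₀ hn1
  have hrl : r * lam ≤ 1 := by nlinarith
  set p : ℝ := ((Measure.pi fun _ : Fin ℓ => expMeasure r) {x | W B lam ℓ (B-1) x}).toReal with hp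
  have hpA : ∀ γ : Path n ℓ, (P n).real (A B lam (B-1) γ) = p := by
    intro γ
    rw [Measure.real, P_A hn]
  have hprob := isProbabilityMeasure_expMeasure hr0
  have hplow : (r*lam*Real.exp (1-r*lam)/(1+β^2))^ℓ*(Real.sin (β*(B-1))*Real.exp (-(1-r*lam)*(B-1))) ≤ p := by
    have h := W_lower hβ0 hβ1 hl hr0 hrl ℓ (B-1) (by linarith) (by rw [hβB]; linarith)
    rw [hβB] at h
    rw [hp]
    exact (ENNReal.ofReal_le_iff_le_toReal (measure_ne_top _ _)).1 h
  have hsm := second_moment (P n) (fun γ : Path n ℓ => A B lam (B-1) γ) (fun γ => A_meas _ _ _ γ) p _ hpA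
    (pair_sum hn hl hle hB1 hδ p hpA)
  set K := Real.exp 1 * (ℓ * ((ℓ + 1) * (2 * (Real.exp B * (2 * ℓ + 1))))) with hK
  set m : ℝ := (Fintype.card (Path n ℓ) : ℝ) with hm
  have hm1 := card_path_ge n ℓ h2 hn
  have hqm : q ≤ m * p := by
    refine hq.trans ?_
    have hsin : β / 2 ≤ Real.sin (β * (B-1)) := by
      have h1 : β * (B-1) = Real.pi - β := by rw [hβ]; field_simp
      rw [h1, Real.sin_pi_sub]
      have h2 := Real.mul_le_sin hβ0.le (by linarith)
      refine le_trans ?_ h2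
      have h3 : 1/2 ≤ 2 / Real.pi := by
        rw [div_le_div_iff₀ (by norm_num) Real.pi_pos]; linarith [Real.pi_le_four]
      nlinarith
    have hexp : Real.exp (-B) ≤ Real.exp (-(1-r*lam)*(B-1)) := by
      apply Real.exp_le_exp.2
      have : 0 ≤ r * lam := by positivity
      nlinarith
    have hk : (Real.exp 1 * lam)^ℓ * Real.exp (-1) * Real.exp (-(β^2 * ℓ)) ≤
        (n:ℝ)^ℓ * (r*lam*Real.exp (1-r*lam)/(1+β^2))^ℓ := by
      have h1 : (n:ℝ)^ℓ * (r*lam*Real.exp (1-r*lam)/(1+β^2))^ℓ =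
          (Real.exp 1 * lam)^ℓ * (Real.exp (-(r*lam)))^ℓ * ((1+β^2)⁻¹)^ℓ := by
        rw [← mul_pow, ← mul_pow, ← mul_pow]
        congr 1
        rw [sub_eq_add_neg, Real.exp_add, hr]; field_simp
      rw [h1]
      gcongr
      · rw [← Real.exp_nat_mul]
        apply Real.exp_le_exp.2
        have h3 : (2 * (ℓ * (ℓ+1)) : ℝ) ≤ n := by exact_mod_cast h2
        have h5 : (0:ℝ) ≤ ℓ := by positivity
        have h4 : (ℓ:ℝ) * r ≤ 1 := by
          rw [hr, ← div_eq_mul_inv, div_le_one hn']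
          have h6 : 0 ≤ (ℓ:ℝ) * ℓ := by positivity
          linarith
        have h6 : 0 ≤ (ℓ:ℝ) * r := by positivity
        have h7 : (ℓ:ℝ) * r * lam ≤ 1 * 1 := by gcongr
        linarith
      · have h3 := Real.add_one_le_exp (β^2)
        have : -(β^2 * ℓ) = (ℓ:ℝ) * (-β^2) := by ring
        rw [this, Real.exp_nat_mul]
        gcongr
        rw [Real.exp_neg]
        gcongr
        linarith
    calc _ = ((n:ℝ)/2) * ((Real.exp 1 * lam)^ℓ * Real.exp (-1) * Real.exp (-(β^2 * ℓ))) * ((β/2) * Real.exp (-B)) := by ring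
      _ ≤ ((n:ℝ)/2) * ((n:ℝ)^ℓ * (r*lam*Real.exp (1-r*lam)/(1+β^2))^ℓ) *
            (Real.sin (β*(B-1))*Real.exp (-(1-r*lam)*(B-1))) := by
        gcongr
        exact le_trans (by positivity) hsin
      _ = ((n:ℝ)^(ℓ+1)/2) * ((r*lam*Real.exp (1-r*lam)/(1+β^2))^ℓ *
            (Real.sin (β*(B-1))*Real.exp (-(1-r*lam)*(B-1)))) := by ring
      _ ≤ ((n:ℝ)^(ℓ+1)/2) * p := by gcongr
      _ ≤ m * p := by
        have : 0 ≤ p := ENNReal.toReal_nonneg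
        gcongr
  have hmp : 0 < m * p := lt_of_lt_of_le hq0 hqm
  rw [← ENNReal.ofReal_toReal (measure_ne_top (P n) _)]
  apply ENNReal.ofReal_le_ofReal
  set x := (P n (⋃ γ : Path n ℓ, A B lam (B-1) γ)ᶜ).toReal with hx
  have hx0 : 0 ≤ x := ENNReal.toReal_nonneg
  change (m * p)^2 * x ≤ m * p * K at hsm
  rw [le_div_iff₀ hq0]
  have h3 : (m * p) * x ≤ K := by
    have : (m * p) * ((m*p) * x) ≤ (m * p) * K := by linarith
    exact le_of_mul_le_mul_left this hmp
  calc x * q ≤ x * (m * p) := by gcongr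
    _ ≤ K := by linarith

set_option maxHeartbeats 1000000 in
lemma lower {n : ℕ} (hn : 0 < n) {lam lg : ℝ} (hlg : lg = Real.log n) (hbig : 12800 ≤ lg)
    (hbig2 : 16 * lg^10 * Real.exp (-(lg/2)) ≤ 1)
    (hl : 1/4 ≤ lam) (hε : (lg^2)⁻¹ ≤ Real.exp (-1) - lam) :
    P n {ω | ¬ 1/12800 * (Real.exp (-1) - lam)⁻¹ * lg ≤ (L n lam ω : ℝ)} ≤
      ENNReal.ofReal (2 * Real.exp 3 * lg^10 * Real.exp (-(lg/2))) := by
  have hn' : (0:ℝ) < n := by exact_mod_cast hn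
  have hnlg : (n:ℝ) = Real.exp lg := by rw [hlg, Real.exp_log hn']
  set ε := Real.exp (-1) - lam with hεd
  have hlg0 : 0 < lg := by linarith
  have hε0 : 0 < ε := lt_of_lt_of_le (by positivity) hε
  have hlam : lam = Real.exp (-1) - ε := by rw [hεd]; ring
  have hem1 : Real.exp (-1) ≤ 1 := Real.exp_le_one_iff.2 (by norm_num)
  have hε1 : ε ≤ 1 := by linarith
  have hεinv : ε⁻¹ ≤ lg^2 := by
    rw [inv_le_comm₀ hε0 (by positivity)]; exact hε
  set x : ℝ := 1/12800 * ε⁻¹ * lg with hx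
  have hx1 : 1 ≤ x := by
    have : 1 ≤ ε⁻¹ := (one_le_inv₀ hε0).2 hε1
    rw [hx]; nlinarith
  set ℓ : ℕ := ⌈x⌉₊ with hℓ
  have hℓx : x ≤ ℓ := Nat.le_ceil x
  have hℓx2 : (ℓ:ℝ) ≤ 2 * x := by
    have := Nat.ceil_lt_add_one (show 0 ≤ x by linarith)
    linarith
  have hℓ1 : (1:ℝ) ≤ ℓ := hx1.trans hℓx
  have hℓε : ε * ℓ ≤ lg / 6400 := by
    calc ε * ℓ ≤ ε * (2 * x) := by gcongr
      _ = _ := by rw [hx]; field_simp; norm_num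
  have hℓ3' : (ℓ:ℝ) ≤ lg^3 / 6400 := by
    calc (ℓ:ℝ) ≤ 2 * x := hℓx2
      _ = ε⁻¹ * lg / 6400 := by rw [hx]; ring
      _ ≤ lg^2 * lg / 6400 := by gcongr
      _ = _ := by ring
  have hℓ3 : (ℓ:ℝ) ≤ lg^3 := by
    have : 0 ≤ lg^3 := by positivity
    linarith
  have hlg1 : 1 ≤ lg := by linarith
  have hlg3 : 1 ≤ lg^3 := one_le_pow₀ hlg1
  set B := lg/8 with hB
  set lam' := lam * (ℓ / (ℓ+1)) with hlam'
  have hl0 : 0 < lam := by linarith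
  have hlam'0 : 0 < lam' := by positivity
  have hfr : (ℓ:ℝ)/(ℓ+1) ≤ 1 := by rw [div_le_one (by positivity)]; linarith
  have hel : Real.exp 1 * lam ≤ 1 := by
    have : Real.exp 1 * Real.exp (-1) = 1 := by rw [← Real.exp_add]; simp
    have h1 := Real.exp_pos 1
    rw [hlam]; nlinarith
  have hle : Real.exp 1 * lam' ≤ 1 := by
    calc Real.exp 1 * lam' = (Real.exp 1 * lam) * (ℓ/(ℓ+1)) := by rw [hlam']; ring
      _ ≤ 1 * 1 := by gcongr
      _ = 1 := by norm_num
  have hBpi : Real.pi ≤ B := by have := Real.pi_le_four; rw [hB]; linarith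
  have hEB : 1 ≤ Real.exp B := Real.one_le_exp (by positivity)
  have hneg : Real.exp (-(lg/2)) = (Real.exp (lg/2))⁻¹ := Real.exp_neg _
  have hbig3 : 16 * lg^10 ≤ Real.exp (lg/2) := by
    rw [hneg, ← div_eq_mul_inv, div_le_one (Real.exp_pos _)] at hbig2; exact hbig2
  have hδ : (ℓ:ℝ) * ((ℓ + 1) * (2 * Real.exp B * (2 * ℓ + 1) + 2) / n) ≤ 1 := by
    rw [← mul_div_assoc, div_le_one hn', hnlg]
    calc (ℓ:ℝ) * ((ℓ + 1) * (2 * Real.exp B * (2 * ℓ + 1) + 2))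
        ≤ lg^3 * ((lg^3 + lg^3) * (2 * Real.exp B * (2 * lg^3 + lg^3) + 2 * (Real.exp B * lg^3))) := by
          gcongr
          nlinarith
      _ = 16 * lg^9 * Real.exp B := by ring
      _ ≤ 16 * lg^10 * Real.exp B := by
          gcongr
          norm_num
      _ ≤ Real.exp (lg/2) * Real.exp (lg/2) := by
          gcongr
          rw [hB]; linarith
      _ = Real.exp lg := by rw [← Real.exp_add]; congr 1; ring
  have h2 : 2 * (ℓ * (ℓ+1)) ≤ n := by
    have : (2 * (ℓ * (ℓ+1)) : ℝ) ≤ n := by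
      rw [hnlg]
      calc (2 * (ℓ * (ℓ+1)) : ℝ) ≤ 2 * (lg^3 * (lg^3 + lg^3)) := by gcongr
        _ = 4 * lg^6 := by ring
        _ ≤ 16 * lg^10 := by
          have : lg^6 ≤ lg^10 := pow_le_pow_right₀ hlg1 (by norm_num)
          have : 0 ≤ lg^6 := by positivity
          linarith
        _ ≤ Real.exp (lg/2) := hbig3
        _ ≤ _ := Real.exp_le_exp.2 (by linarith)
    exact_mod_cast this
  set q : ℝ := Real.exp (-2) * (6/lg) * Real.exp (3/4 * lg) with hq
  have hq0 : 0 < q := by positivity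
  have hpow : Real.exp (-1) * Real.exp (-(lg/1600)) ≤ (Real.exp 1 * lam')^ℓ := by
    have h1 : (Real.exp 1 * lam')^ℓ = ((ℓ:ℝ)/(ℓ+1))^ℓ * (Real.exp 1 * lam)^ℓ := by
      rw [← mul_pow, hlam']; congr 1; ring
    rw [h1]
    gcongr
    · have h3 : Real.exp (-(1/ℓ)) ≤ (ℓ:ℝ)/(ℓ+1) := by
        rw [Real.exp_neg]
        have h4 := Real.add_one_le_exp (1/(ℓ:ℝ))
        have h5 : (ℓ:ℝ)/(ℓ+1) = (1/(ℓ:ℝ)+1)⁻¹ := by field_simp; ring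
        rw [h5]
        gcongr
      calc Real.exp (-1) = (Real.exp (-(1/ℓ)))^ℓ := by
            rw [← Real.exp_nat_mul]; congr 1; field_simp
        _ ≤ _ := by gcongr
    · have h3 : Real.exp (-(4*ε)) ≤ Real.exp 1 * lam := by
        have h4 := Real.add_one_le_exp (4*ε)
        have h5 : (Real.exp 1 * lam)⁻¹ ≤ 4 * ε + 1 := by
          rw [inv_le_iff_one_le_mul₀ (by positivity)]
          have h6 : Real.exp 1 * (lam + ε) = 1 := by
            rw [hlam]; ring_nf; rw [← Real.exp_add]; simp
          have h7 : 0 ≤ Real.exp 1 * ε * (4 * lam - 1) :=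
            mul_nonneg (by positivity) (by linarith)
          nlinarith
        rw [Real.exp_neg]
        rw [inv_le_comm₀ (Real.exp_pos _) (by positivity)]
        linarith
      calc Real.exp (-(lg/1600)) ≤ Real.exp (ℓ * (-(4*ε))) := by
            apply Real.exp_le_exp.2; linarith
        _ = (Real.exp (-(4*ε)))^ℓ := by rw [Real.exp_nat_mul]
        _ ≤ _ := by gcongr
  have hβ : (Real.pi / B)^2 * ℓ ≤ lg/10 := by
    have hpi2 : Real.pi^2 ≤ 10 := by have := Real.pi_lt_d2; have := Real.pi_pos; nlinarith
    calc (Real.pi / B)^2 * ℓ = Real.pi^2 * 64 / lg^2 * ℓ := by rw [hB]; field_simp; norm_num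
      _ ≤ 10 * 64 / lg^2 * (lg^3/6400) := by gcongr
      _ = _ := by field_simp; norm_num
  have hqle : q ≤ (n:ℝ) / 2 * (Real.exp 1 * lam')^ℓ * Real.exp (-1) * Real.exp (-((Real.pi / B)^2 * ℓ)) *
      (Real.pi / B / 2) * Real.exp (-B) := by
    have hpb : 12 / lg ≤ Real.pi / B / 2 := by
      have : Real.pi / B / 2 = 4 * Real.pi / lg := by rw [hB]; field_simp; norm_num
      rw [this]; gcongr; linarith [Real.pi_gt_three]
    calc q ≤ Real.exp lg / 2 * (Real.exp (-1) * Real.exp (-(lg/1600))) * Real.exp (-1) * Real.exp (-(lg/10)) *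
          (12/lg) * Real.exp (-B) := by
          have e : Real.exp lg / 2 * (Real.exp (-1) * Real.exp (-(lg/1600))) * Real.exp (-1) * Real.exp (-(lg/10)) *
            (12/lg) * Real.exp (-B) = Real.exp (-2) * (6/lg) * Real.exp (lg - lg/1600 - lg/10 - B) := by
            have e1 : Real.exp (-2) = Real.exp (-1) * Real.exp (-1) := by rw [← Real.exp_add]; norm_num
            have e2 : Real.exp (lg - lg/1600 - lg/10 - B) = Real.exp lg * Real.exp (-(lg/1600)) * Real.exp (-(lg/10)) * Real.exp (-B) := by
              rw [← Real.exp_add, ← Real.exp_add, ← Real.exp_add]; congr 1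
            rw [e1, e2]; ring
          rw [e, hq]
          gcongr
          rw [hB]; linarith
      _ ≤ _ := by rw [hnlg]; gcongr
  have hmain := lower_gen hn hlam'0 hle hBpi hδ h2 hq0 hqle
  refine le_trans (measure_mono ?_) (hmain.trans (ENNReal.ofReal_le_ofReal ?_))
  · intro ω hω hmem
    apply hω
    obtain ⟨γ, hγ⟩ := Set.mem_iUnion.1 hmem
    refine hℓx.trans ?_
    have hw := W_total hlam'0 ℓ (B-1) _ (by linarith [Real.pi_gt_three]) (by linarith) hγ
    have : weight ω γ ≤ lam * ℓ := by
      refine hw.trans (le_of_eq ?_)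
      rw [hlam']; field_simp; ring
    exact_mod_cast le_L γ this
  · rw [div_le_iff₀ hq0]
    have e1 : 2 * Real.exp 3 * lg^10 * Real.exp (-(lg/2)) * q = 12 * Real.exp 1 * lg^9 * Real.exp (lg/4) := by
      have e2 : Real.exp 1 = Real.exp 3 * Real.exp (-2) := by rw [← Real.exp_add]; norm_num
      have e3 : Real.exp (lg/4) = Real.exp (-(lg/2)) * Real.exp (3/4*lg) := by rw [← Real.exp_add]; congr 1; ring
      rw [e2, e3, hq]; field_simp; norm_num
    rw [e1]
    calc Real.exp 1 * (ℓ * ((ℓ + 1) * (2 * (Real.exp B * (2 * ℓ + 1)))))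
        ≤ Real.exp 1 * (lg^3 * ((lg^3 + lg^3) * (2 * (Real.exp B * (2 * lg^3 + lg^3))))) := by gcongr
      _ = 12 * Real.exp 1 * lg^9 * Real.exp B := by ring
      _ ≤ _ := by gcongr; rw [hB]; linarith

lemma tend_aux (k : ℝ) : Tendsto (fun n : ℕ => k * (Real.log n)^10 * Real.exp (-(Real.log n/2))) atTop (nhds 0) := by
  have h1 := Real.tendsto_pow_mul_exp_neg_atTop_nhds_zero 10
  have hlog : Tendsto (fun n : ℕ => Real.log n / 2) atTop atTop :=
    (Real.tendsto_log_atTop.comp tendsto_natCast_atTop_atTop).atTop_div_const (by norm_num)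
  have h2 := (h1.comp hlog).const_mul (k * 2^10)
  rw [mul_zero] at h2
  refine h2.congr ?_
  intro n
  simp only [Function.comp]
  ring

/-- Theorem 3 (near-subcritical regime): there are absolute constants C, c > 0 such that
uniformly over 1/4 ≤ λ ≤ e⁻¹ - (log n)⁻², with probability tending to one,
c (e⁻¹ - λ)⁻¹ log n ≤ L(n,λ) ≤ C (e⁻¹ - λ)⁻¹ log n. -/
theorem subcritical :
    ∃ C c : ℝ, 0 < C ∧ 0 < c ∧
      Tendsto (fun n : ℕ =>
          ⨅ lam ∈ Set.Icc (1 / 4 : ℝ) (Real.exp (-1) - ((Real.log n) ^ 2)⁻¹),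
            P n {ω | c * (Real.exp (-1) - lam)⁻¹ * Real.log n ≤ (L n lam ω : ℝ) ∧
                     (L n lam ω : ℝ) ≤ C * (Real.exp (-1) - lam)⁻¹ * Real.log n})
        atTop (nhds 1) := by
  refine ⟨2, 1/12800, by norm_num, by norm_num, ?_⟩
  have hlog : Tendsto (fun n : ℕ => Real.log n) atTop atTop :=
    Real.tendsto_log_atTop.comp tendsto_natCast_atTop_atTop
  have hbad : Tendsto (fun n : ℕ => 1 - (ENNReal.ofReal (2 * Real.exp 3 * (Real.log n)^10 * Real.exp (-(Real.log n/2))) +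
      ENNReal.ofReal (Real.exp (-2 * Real.log n)))) atTop (nhds 1) := by
    have h1 := ENNReal.tendsto_ofReal (tend_aux (2 * Real.exp 3))
    have h2 : Tendsto (fun n : ℕ => Real.exp (-2 * Real.log n)) atTop (nhds 0) :=
      Real.tendsto_exp_atBot.comp (hlog.const_mul_atTop_of_neg (by norm_num))
    have h3 := h1.add (ENNReal.tendsto_ofReal h2)
    have h4 := ENNReal.Tendsto.sub (tendsto_const_nhds (x := (1:ENNReal)) (f := atTop)) h3 (Or.inl ENNReal.one_ne_top)
    simpa using! h4
  refine tendsto_of_tendsto_of_tendsto_of_le_of_le' hbad tendsto_const_nhds ?_ ?_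
  · filter_upwards [eventually_gt_atTop 0, hlog.eventually_ge_atTop 12800,
      (tend_aux 16).eventually_le_const (show (0:ℝ) < 1 by norm_num)] with n hn hb hb2
    refine le_iInf₂ fun lam hlam => ?_
    have hε : ((Real.log n)^2)⁻¹ ≤ Real.exp (-1) - lam := by linarith [hlam.2]
    have hε0 : 0 < Real.exp (-1) - lam := lt_of_lt_of_le (by positivity) hε
    have h1 := lower hn rfl hb hb2 hlam.1 hε
    have h2 := upper hn (show 0 < lam by linarith [hlam.1]) hε0
    have := P_prob hn
    refine tsub_le_iff_right.2 ?_
    rw [← measure_univ (μ := P n)]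
    refine le_trans ?_ (add_le_add le_rfl (add_le_add h1 h2))
    refine le_trans (measure_mono ?_) ((measure_union_le _ _).trans (add_le_add le_rfl (measure_union_le _ _)))
    intro ω _
    simp only [Set.mem_union, Set.mem_ofPred_eq]
    tauto
  · filter_upwards [eventually_gt_atTop 0, hlog.eventually_ge_atTop 12800] with n hn hb
    have := P_prob hn
    have hne : (1/4:ℝ) ∈ Set.Icc (1 / 4 : ℝ) (Real.exp (-1) - ((Real.log n) ^ 2)⁻¹) := by
      refine ⟨le_rfl, ?_⟩
      have h1 : ((Real.log n) ^ 2)⁻¹ ≤ 1/100 := by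
        rw [inv_le_comm₀ (by positivity) (by norm_num)]
        nlinarith
      have h2 : (1/3:ℝ) ≤ Real.exp (-1) := by
        rw [Real.exp_neg, inv_eq_one_div]
        gcongr
        linarith [Real.exp_one_lt_d9]
      linarith
    exact (iInf₂_le _ hne).trans prob_le_one

end Paper
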